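/- arXiv:1801.01412 — 2 statements merged into one kernel-verified Lean document; each statement's English description precedes it below -/
import Mathlib

section
/- Let T, p, q, P, Q be as in the setup and ε > 0. Suppose there exist invertible upper-triangular matrices g ∈ Mat_m(ℂ) and h ∈ Mat_n(ℂ) with ‖g† T(h h†) g − Q‖ ≤ ε and ‖h† T*(g g†) h − P‖ ≤ ε. Then |Tr(Q) − Tr(P)| ≤ (√n + √m)·ε, and for every T-independent pair of subspaces (L, R): Σ_{i=1}^m Δq_i·dim(E_i ∩ L) + Σ_{j=1}^n Δp_j·dim(F_j ∩ R) ≤ Tr(P) + (√n + √m)·ε. -/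
open Matrix BigOperators

noncomputable section

/-- `η_j` : the projection onto the first `j` coordinates, as a `j × k` matrix. -/
def proj (j k : ℕ) : Matrix (Fin j) (Fin k) ℂ :=
  Matrix.of fun i l => if (i : ℕ) = (l : ℕ) then 1 else 0

/-- `Δa_j = a_j − a_{j+1}`, with the convention `a_{k+1} = 0`. -/
def delta {k : ℕ} (a : Fin k → ℝ) (j : Fin k) : ℝ :=
  a j - (if h : (j : ℕ) + 1 < k then a ⟨(j : ℕ) + 1, h⟩ else 0)

/-- Integer version of `delta`. -/
def deltaNat {k : ℕ} (a : Fin k → ℕ) (j : Fin k) : ℕ :=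
  a j - (if h : (j : ℕ) + 1 < k then a ⟨(j : ℕ) + 1, h⟩ else 0)

/-- The relative determinant `det(diag a, X) = ∏_j det(η_j X η_j†)^{Δa_j}` (real exponents,
with the convention `0 ^ 0 = 1`). -/
def relDet {k : ℕ} (a : Fin k → ℝ) (X : Matrix (Fin k) (Fin k) ℂ) : ℝ :=
  ∏ j : Fin k,
    ((proj ((j : ℕ) + 1) k * X * (proj ((j : ℕ) + 1) k)ᴴ).det.re) ^ (delta a j)

/-- Complex relative determinant for integral weights. -/
def relDetC {k : ℕ} (a : Fin k → ℕ) (X : Matrix (Fin k) (Fin k) ℂ) : ℂ :=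
  ∏ j : Fin k,
    ((proj ((j : ℕ) + 1) k * X * (proj ((j : ℕ) + 1) k)ᴴ).det) ^ (deltaNat a j)

/-- The completely positive map `T(X) = Σ A_i X A_i†` with Kraus operators `A i`. -/
def cpMap {ι κ : Type*} [Fintype ι] {r : ℕ} (A : Fin r → Matrix κ ι ℂ)
    (X : Matrix ι ι ℂ) : Matrix κ κ ℂ :=
  ∑ i, A i * X * (A i)ᴴ

/-- The dual completely positive map `T*(Y) = Σ A_i† Y A_i`. -/
def cpDual {ι κ : Type*} [Fintype κ] {r : ℕ} (A : Fin r → Matrix κ ι ℂ)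
    (Y : Matrix κ κ ℂ) : Matrix ι ι ℂ :=
  ∑ i, (A i)ᴴ * Y * A i

/-- Frobenius norm `‖A‖ = √(Tr A Aᴴ)`. -/
def frob {ι κ : Type*} [Fintype ι] [Fintype κ] (A : Matrix ι κ ℂ) : ℝ :=
  Real.sqrt (A * Aᴴ).trace.re

/-- Upper triangular predicate. -/
def UT {k : ℕ} (g : Matrix (Fin k) (Fin k) ℂ) : Prop :=
  ∀ i j : Fin k, j < i → g i j = 0

/-- Capacity with specified marginals:
`cap(T,P,Q) = inf over invertible upper triangular h of det(Q, T(hPh†)) / det(P, h†h)`. -/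
def cap {n m r : ℕ} (A : Fin r → Matrix (Fin m) (Fin n) ℂ)
    (p : Fin n → ℝ) (q : Fin m → ℝ) : ℝ :=
  sInf { x : ℝ | ∃ h : Matrix (Fin n) (Fin n) ℂ, IsUnit h.det ∧ UT h ∧
    x = relDet q (cpMap A (h * Matrix.diagonal (fun j => (p j : ℂ)) * hᴴ)) /
        relDet p (hᴴ * h) }

/-- Span of the first `i` standard basis vectors of `ℂ^k`. -/
def coordSub (k i : ℕ) : Submodule ℂ (Fin k → ℂ) where
  carrier := { x | ∀ l : Fin k, i ≤ (l : ℕ) → x l = 0 }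
  add_mem' := by intro a b ha hb l hl; simp [ha l hl, hb l hl]
  zero_mem' := by intro l _; rfl
  smul_mem' := by intro c x hx l hl; simp [hx l hl]

/-- `(L, R)` is a `T`-independent pair: `A_i R ⊥ L` for all `i`. -/
def TIndep {n m r : ℕ} (A : Fin r → Matrix (Fin m) (Fin n) ℂ)
    (L : Submodule ℂ (Fin m → ℂ)) (R : Submodule ℂ (Fin n → ℂ)) : Prop :=
  ∀ i : Fin r, ∀ x ∈ R, ∀ y ∈ L, star y ⬝ᵥ (A i).mulVec x = 0

/-- `(P,Q)`-rank-nondecreasingness. -/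
def rankNonDec {n m r : ℕ} (A : Fin r → Matrix (Fin m) (Fin n) ℂ)
    (p : Fin n → ℝ) (q : Fin m → ℝ) : Prop :=
  ∀ L : Submodule ℂ (Fin m → ℂ), ∀ R : Submodule ℂ (Fin n → ℂ), TIndep A L R →
    (∑ i : Fin m, delta q i * (Module.finrank ℂ ↥(coordSub m ((i : ℕ) + 1) ⊓ L) : ℝ)) +
      (∑ j : Fin n, delta p j * (Module.finrank ℂ ↥(coordSub n ((j : ℕ) + 1) ⊓ R) : ℝ))
      ≤ ∑ j, p j

/-- `λ'_{i+1}`: number of parts of `lam` that are `> i` (0-indexed conjugate partition). -/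
def conj' {k : ℕ} (lam : Fin k → ℕ) (i : ℕ) : ℕ :=
  (Finset.univ.filter fun j : Fin k => i < lam j).card

lemma conj'_le {k : ℕ} (lam : Fin k → ℕ) (i : ℕ) : conj' lam i ≤ k := by
  classical
  calc conj' lam i ≤ Finset.univ.card := Finset.card_filter_le _ _
    _ = k := by simp

/-- Index set for the blocks of `G_λ`; it has cardinality `Σ_i λ'_i = Σ_j λ_j`. -/
abbrev lamIdx {k : ℕ} (lam : Fin k → ℕ) : Type :=
  Σ i : Fin (Finset.univ.sup lam), Fin (conj' lam (i : ℕ))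

/-- The gadget map `G_λ(X) = ⊕_{i=1}^{λ_1} η_{λ'_i} X η_{λ'_i}†`. -/
def Gmap {k : ℕ} (lam : Fin k → ℕ) (X : Matrix (Fin k) (Fin k) ℂ) :
    Matrix (lamIdx lam) (lamIdx lam) ℂ := fun s t =>
  if s.1 = t.1 then
    X (Fin.castLE (conj'_le lam (s.1 : ℕ)) s.2) (Fin.castLE (conj'_le lam (t.1 : ℕ)) t.2)
  else 0

/-- The adjoint `G_λ*` of the gadget map with respect to the trace inner product. -/
def GmapAdj {k : ℕ} (lam : Fin k → ℕ) (Y : Matrix (lamIdx lam) (lamIdx lam) ℂ) :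
    Matrix (Fin k) (Fin k) ℂ := fun a b =>
  ∑ i : Fin (Finset.univ.sup lam),
    if h : (a : ℕ) < conj' lam (i : ℕ) ∧ (b : ℕ) < conj' lam (i : ℕ) then
      Y ⟨i, ⟨(a : ℕ), h.1⟩⟩ ⟨i, ⟨(b : ℕ), h.2⟩⟩
    else 0

/-- The reduction `trun_{P,Q} T = G_q ∘ T ∘ G_p*`. -/
def trun {n m r : ℕ} (A : Fin r → Matrix (Fin m) (Fin n) ℂ) (p : Fin n → ℕ) (q : Fin m → ℕ)
    (X : Matrix (lamIdx p) (lamIdx p) ℂ) : Matrix (lamIdx q) (lamIdx q) ℂ :=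
  Gmap q (cpMap A (GmapAdj p X))

/-- The dual of the reduction: `(trun_{P,Q} T)* = G_p ∘ T* ∘ G_q*`. -/
def trunDual {n m r : ℕ} (A : Fin r → Matrix (Fin m) (Fin n) ℂ) (p : Fin n → ℕ) (q : Fin m → ℕ)
    (Y : Matrix (lamIdx q) (lamIdx q) ℂ) : Matrix (lamIdx p) (lamIdx p) ℂ :=
  Gmap p (cpDual A (GmapAdj q Y))

/-- Shannon entropy with convention `0 · log 0 = 0` (note `Real.log 0 = 0`). -/
def entropy {k : ℕ} (p : Fin k → ℝ) : ℝ := -∑ j, p j * Real.log (p j)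

/-- The distance-to-target measure `ds_{P,Q}(T)`. -/
def ds {n m r : ℕ} (A : Fin r → Matrix (Fin m) (Fin n) ℂ)
    (p : Fin n → ℝ) (q : Fin m → ℝ) : ℝ :=
  (∑ j : Fin n, delta p j *
      (frob (proj ((j : ℕ) + 1) n *
        (cpDual A (Matrix.diagonal fun i => (q i : ℂ)) - 1) * (proj ((j : ℕ) + 1) n)ᴴ)) ^ 2) +
    ∑ i : Fin m, delta q i *
      (frob (proj ((i : ℕ) + 1) m *
        (cpMap A (Matrix.diagonal fun j => (p j : ℂ)) - 1) * (proj ((i : ℕ) + 1) m)ᴴ)) ^ 2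

/-- `(u_1,…,u_n)` can be approximately put in `Q`-isotropic position with respect to `p`. -/
def approxIso {m n : ℕ} (u : Fin n → Fin m → ℂ) (p : Fin n → ℝ)
    (Q : Matrix (Fin m) (Fin m) ℂ) : Prop :=
  ∀ ε : ℝ, 0 < ε → ∃ B : Matrix (Fin m) (Fin m) ℂ, IsUnit B.det ∧
    frob ((∑ i : Fin n,
      (((p i / ∑ a, Complex.normSq (B.mulVec (u i) a)) : ℝ) : ℂ) •
        Matrix.vecMulVec (B.mulVec (u i)) (star (B.mulVec (u i)))) - Q) ≤ ε

lemma re_trace_mul_conjTranspose {ι κ : Type*} [Fintype ι] [Fintype κ] (M : Matrix ι κ ℂ) :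
    (M * Mᴴ).trace.re = ∑ i, ∑ j, ‖M i j‖ ^ 2 := by
  simp only [Matrix.trace, Matrix.diag_apply, Matrix.mul_apply, Matrix.conjTranspose_apply,
    Complex.re_sum]
  refine Finset.sum_congr rfl fun i _ => Finset.sum_congr rfl fun j _ => ?_
  rw [RCLike.star_def, Complex.mul_conj, Complex.ofReal_re, Complex.normSq_eq_norm_sq]

lemma re_trace_mul_conjTranspose_nonneg {ι κ : Type*} [Fintype ι] [Fintype κ]
    (M : Matrix ι κ ℂ) : 0 ≤ (M * Mᴴ).trace.re := by
  rw [re_trace_mul_conjTranspose]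
  positivity

lemma abs_re_trace_mul_le {ι κ : Type*} [Fintype ι] [Fintype κ]
    (N : Matrix ι κ ℂ) (M : Matrix κ ι ℂ) : |(N * M).trace.re| ≤ frob N * frob M := by
  unfold frob
  rw [re_trace_mul_conjTranspose, re_trace_mul_conjTranspose,
    Finset.sum_comm (f := fun i j => ‖M i j‖ ^ 2), ← Fintype.sum_prod_type',
    ← Fintype.sum_prod_type']
  refine le_trans ?_ (Real.sum_mul_le_sqrt_mul_sqrt _ _ _)
  rw [Fintype.sum_prod_type]
  refine (Complex.abs_re_le_norm _).trans ?_
  simp only [Matrix.trace, Matrix.diag_apply, Matrix.mul_apply]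
  refine (norm_sum_le _ _).trans (Finset.sum_le_sum fun i _ => ?_)
  refine (norm_sum_le _ _).trans (Finset.sum_le_sum fun j _ => ?_)
  rw [norm_mul]

/-- `Φ` is the matrix of the orthogonal projection onto `S`. -/
structure IsOrthProj {k : ℕ} (Φ : Matrix (Fin k) (Fin k) ℂ) (S : Submodule ℂ (Fin k → ℂ)) :
    Prop where
  conjTranspose_eq : Φᴴ = Φ
  mulVec_mem : ∀ x, Φ *ᵥ x ∈ S
  mulVec_eq : ∀ x ∈ S, Φ *ᵥ x = x

lemma exists_isOrthProj {k : ℕ} (S : Submodule ℂ (Fin k → ℂ)) : ∃ Φ, IsOrthProj Φ S := by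
  let K : Submodule ℂ (EuclideanSpace ℂ (Fin k)) :=
    S.comap (WithLp.linearEquiv 2 ℂ (Fin k → ℂ)).toLinearMap
  let Φ := (Matrix.toEuclideanCLM (n := Fin k) (𝕜 := ℂ)).symm K.starProjection
  have hΦ : Matrix.toEuclideanCLM (n := Fin k) (𝕜 := ℂ) Φ = K.starProjection :=
    StarAlgEquiv.apply_symm_apply _ _
  have hx : ∀ x, Φ *ᵥ x = WithLp.ofLp (K.starProjection (WithLp.toLp 2 x)) := by
    intro x
    rw [← hΦ, Matrix.ofLp_toEuclideanCLM]
  refine ⟨Φ, ?_, fun x => ?_, fun x hxS => ?_⟩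
  · have h : star Φ = Φ := by
      let e := (Matrix.toEuclideanCLM (n := Fin k) (𝕜 := ℂ)).symm
      exact (e.map_star' _).symm.trans (congrArg e (isSelfAdjoint_starProjection K))
    exact h
  · rw [hx]
    exact K.starProjection_apply_mem _
  · rw [hx, Submodule.starProjection_eq_self_iff.2]
    exact hxS

namespace IsOrthProj

variable {k : ℕ} {Φ Ψ : Matrix (Fin k) (Fin k) ℂ} {S U : Submodule ℂ (Fin k → ℂ)}

lemma mul_eq_of_le (hΦ : IsOrthProj Φ S) (hΨ : IsOrthProj Ψ U) (hSU : U ≤ S) :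
    Φ * Ψ = Ψ := by
  refine Matrix.ext_of_mulVec_single fun i => ?_
  rw [← Matrix.mulVec_mulVec, hΦ.mulVec_eq _ (hSU (hΨ.mulVec_mem _))]

lemma mul_eq_of_le' (hΦ : IsOrthProj Φ S) (hΨ : IsOrthProj Ψ U) (hSU : U ≤ S) :
    Ψ * Φ = Ψ := by
  have h := congrArg Matrix.conjTranspose (hΦ.mul_eq_of_le hΨ hSU)
  rwa [Matrix.conjTranspose_mul, hΦ.conjTranspose_eq, hΨ.conjTranspose_eq] at h

lemma mul_self (hΦ : IsOrthProj Φ S) : Φ * Φ = Φ := hΦ.mul_eq_of_le hΦ le_rfl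

lemma trace_eq (hΦ : IsOrthProj Φ S) : Φ.trace = Module.finrank ℂ S := by
  have h : LinearMap.IsProj S (Matrix.toLin' Φ) :=
    ⟨fun x => by simpa using hΦ.mulVec_mem x, fun x hx => by simpa using hΦ.mulVec_eq x hx⟩
  rw [← h.trace, Matrix.trace_toLin'_eq]

lemma frob_le (hΦ : IsOrthProj Φ S) : frob Φ ≤ Real.sqrt k := by
  unfold frob
  refine Real.sqrt_le_sqrt ?_
  rw [hΦ.conjTranspose_eq, hΦ.mul_self, hΦ.trace_eq, Complex.natCast_re]
  exact_mod_cast (Submodule.finrank_le S).trans_eq (by simp)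

lemma compl (hΦ : IsOrthProj Φ S) : IsOrthProj (1 - Φ) (LinearMap.ker (Matrix.toLin' Φ)) where
  conjTranspose_eq := by simp [hΦ.conjTranspose_eq]
  mulVec_mem x := by
    simp [Matrix.sub_mulVec, Matrix.mulVec_sub, hΦ.mul_self]
  mulVec_eq x hx := by
    have hx' : Φ *ᵥ x = 0 := by simpa using hx
    simp [Matrix.sub_mulVec, hx']

/-- The dimension of `coordSub k i ⊓ S` is at most the sum of the first `i` diagonal entries of
the projection onto `S`. -/
lemma finrank_inf_coordSub_le (hΦ : IsOrthProj Φ S) (i : ℕ) :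
    (Module.finrank ℂ ↥(coordSub k i ⊓ S) : ℝ) ≤
      ∑ l : Fin k, if (l : ℕ) < i then (Φ l l).re else 0 := by
  obtain ⟨Ψ, hΨ⟩ := exists_isOrthProj (coordSub k i ⊓ S)
  let η : Matrix (Fin k) (Fin k) ℂ := Matrix.diagonal fun l => if (l : ℕ) < i then 1 else 0
  have hη : IsOrthProj η (coordSub k i) := by
    refine ⟨?_, fun x l hl => ?_, fun x hx => funext fun l => ?_⟩
    · rw [Matrix.diagonal_conjTranspose]
      congr 1
      funext l
      by_cases hl : (l : ℕ) < i <;> simp [hl]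
    · simp [η, Matrix.mulVec_diagonal, hl]
    · by_cases hl : (l : ℕ) < i
      · simp [η, Matrix.mulVec_diagonal, hl]
      · simp [η, Matrix.mulVec_diagonal, hl, hx l (not_lt.1 hl)]
  have hΨη : Ψ * η = Ψ := hη.mul_eq_of_le' hΨ inf_le_left
  have hsq : (η * (Φ - Ψ)) * (η * (Φ - Ψ))ᴴ = η * (Φ - Ψ) * η := by
    rw [Matrix.conjTranspose_mul, Matrix.conjTranspose_sub, hη.conjTranspose_eq,
      hΦ.conjTranspose_eq, hΨ.conjTranspose_eq]
    have : (Φ - Ψ) * (Φ - Ψ) = Φ - Ψ := by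
      rw [sub_mul, mul_sub, mul_sub, hΦ.mul_self, hΨ.mul_self, hΦ.mul_eq_of_le hΨ inf_le_right,
        hΦ.mul_eq_of_le' hΨ inf_le_right]
      abel
    rw [← mul_assoc, mul_assoc η, this]
  have hpos := re_trace_mul_conjTranspose_nonneg (η * (Φ - Ψ))
  rw [hsq, Matrix.trace_mul_comm, ← mul_assoc, hη.mul_self, Matrix.trace_mul_comm, sub_mul, hΨη,
    Matrix.trace_sub, hΨ.trace_eq, Complex.sub_re, Complex.natCast_re, sub_nonneg] at hpos
  refine hpos.trans_eq ?_
  simp only [Matrix.trace, Matrix.diag_apply, η, Matrix.mul_diagonal, Complex.re_sum]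
  refine Finset.sum_congr rfl fun l _ => ?_
  by_cases hl : (l : ℕ) < i <;> simp [hl]

end IsOrthProj

lemma delta_nonneg {k : ℕ} {a : Fin k → ℝ} (ha : Antitone a) (ha0 : ∀ j, 0 ≤ a j) (j : Fin k) :
    0 ≤ delta a j := by
  unfold delta
  split_ifs with h
  · exact sub_nonneg.2 (ha (Fin.le_def.2 (Nat.le_succ _)))
  · simpa using ha0 j

/-- Abel summation for `delta`. -/
lemma sum_delta_mul {k : ℕ} (a d : Fin k → ℝ) :
    ∑ i, delta a i * ∑ l : Fin k, (if (l : ℕ) < (i : ℕ) + 1 then d l else 0) =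
      ∑ i, a i * d i := by
  let a' : ℕ → ℝ := fun i => if h : i < k then a ⟨i, h⟩ else 0
  let d' : ℕ → ℝ := fun i => if h : i < k then d ⟨i, h⟩ else 0
  have key : ∀ N, ∑ i ∈ Finset.range N, (a' i - a' (i + 1)) * ∑ l ∈ Finset.range (i + 1), d' l =
      ∑ i ∈ Finset.range N, a' i * d' i - a' N * ∑ l ∈ Finset.range N, d' l := by
    intro N
    induction N with
    | zero => simp
    | succ N ih =>
      rw [Finset.sum_range_succ, ih, Finset.sum_range_succ (fun i => a' i * d' i),
        Finset.sum_range_succ d']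
      ring
  have hk := key k
  have hak : a' k = 0 := by simp [a']
  rw [hak, zero_mul, sub_zero, ← Fin.sum_univ_eq_sum_range (fun i => a' i * d' i),
    ← Fin.sum_univ_eq_sum_range
      (fun i => (a' i - a' (i + 1)) * ∑ l ∈ Finset.range (i + 1), d' l)] at hk
  convert hk using 2 with i _ i _
  · congr 1
    · simp [delta, a']
    · have hsub : Finset.range ((i : ℕ) + 1) = {l ∈ Finset.range k | l < (i : ℕ) + 1} := by
        ext l
        simp only [Finset.mem_range, Finset.mem_filter]
        omega
      rw [hsub, Finset.sum_filter,
        ← Fin.sum_univ_eq_sum_range (fun l => if l < (i : ℕ) + 1 then d' l else 0)]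
      simp [d']
  · simp [a', d']

lemma IsOrthProj.sum_delta_mul_finrank_le {k : ℕ} {Φ : Matrix (Fin k) (Fin k) ℂ}
    {S : Submodule ℂ (Fin k → ℂ)} (hΦ : IsOrthProj Φ S) {a : Fin k → ℝ} (ha : Antitone a)
    (ha0 : ∀ j, 0 ≤ a j) :
    ∑ i : Fin k, delta a i * (Module.finrank ℂ ↥(coordSub k ((i : ℕ) + 1) ⊓ S) : ℝ) ≤
      (Φ * Matrix.diagonal fun i => (a i : ℂ)).trace.re := by
  calc _ ≤ ∑ i : Fin k, delta a i *
        ∑ l : Fin k, (if (l : ℕ) < (i : ℕ) + 1 then (Φ l l).re else 0) :=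
        Finset.sum_le_sum fun i _ => mul_le_mul_of_nonneg_left (hΦ.finrank_inf_coordSub_le _)
          (delta_nonneg ha ha0 i)
    _ = _ := by
        rw [sum_delta_mul]
        simp [Matrix.trace, Matrix.mul_diagonal, mul_comm]

/-- Invertible upper triangular matrices preserve the coordinate flag. -/
lemma finrank_coordSub_inf_comap {k : ℕ} {g : Matrix (Fin k) (Fin k) ℂ} (hg : IsUnit g.det)
    (hgu : UT g) (S : Submodule ℂ (Fin k → ℂ)) (i : ℕ) :
    Module.finrank ℂ ↥(coordSub k i ⊓ S.comap (Matrix.toLin' g)) =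
      Module.finrank ℂ ↥(coordSub k i ⊓ S) := by
  let e : (Fin k → ℂ) ≃ₗ[ℂ] (Fin k → ℂ) :=
    Matrix.toLin'OfInv (Matrix.nonsing_inv_mul g hg) (Matrix.mul_nonsing_inv g hg)
  have he : e.toLinearMap = Matrix.toLin' g := by
    ext x
    rfl
  have hle : (coordSub k i).map e.toLinearMap ≤ coordSub k i := by
    rintro _ ⟨x, hx, rfl⟩ l hl
    rw [he, Matrix.toLin'_apply]
    change ∑ j, g l j * x j = 0
    refine Finset.sum_eq_zero fun j _ => ?_
    rcases lt_or_ge j l with hj | hj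
    · rw [hgu l j hj, zero_mul]
    · rw [hx j (hl.trans (Fin.le_def.1 hj)), mul_zero]
  have heq : (coordSub k i).map e.toLinearMap = coordSub k i :=
    Submodule.eq_of_le_of_finrank_eq hle (LinearEquiv.finrank_map_eq e _)
  rw [← he, ← LinearEquiv.finrank_map_eq e, Submodule.map_inf _ e.injective, heq,
    Submodule.map_comap_eq_of_surjective e.surjective]

lemma conjTranspose_mul_cpMap_mul {m n r : ℕ} (A : Fin r → Matrix (Fin m) (Fin n) ℂ)
    (g : Matrix (Fin m) (Fin m) ℂ) (h : Matrix (Fin n) (Fin n) ℂ) :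
    gᴴ * cpMap A (h * hᴴ) * g = ∑ i, (gᴴ * A i * h) * (gᴴ * A i * h)ᴴ := by
  simp [cpMap, Matrix.mul_sum, Matrix.sum_mul, Matrix.mul_assoc]

lemma conjTranspose_mul_cpDual_mul {m n r : ℕ} (A : Fin r → Matrix (Fin m) (Fin n) ℂ)
    (g : Matrix (Fin m) (Fin m) ℂ) (h : Matrix (Fin n) (Fin n) ℂ) :
    hᴴ * cpDual A (g * gᴴ) * h = ∑ i, (gᴴ * A i * h)ᴴ * (gᴴ * A i * h) := by
  simp [cpDual, Matrix.mul_sum, Matrix.sum_mul, Matrix.mul_assoc]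

/-- If `Φ B Ψ = 0` for projections `Φ`, `Ψ`, then `‖Φ B‖² + ‖B Ψ‖² ≤ ‖B‖²`. -/
lemma IsOrthProj.re_trace_add_le {m n : ℕ} {Φ : Matrix (Fin m) (Fin m) ℂ}
    {Ψ : Matrix (Fin n) (Fin n) ℂ} {S : Submodule ℂ (Fin m → ℂ)} {U : Submodule ℂ (Fin n → ℂ)}
    (hΦ : IsOrthProj Φ S) (hΨ : IsOrthProj Ψ U) {B : Matrix (Fin m) (Fin n) ℂ}
    (hB : Φ * B * Ψ = 0) :
    (Φ * (B * Bᴴ)).trace.re + (Ψ * (Bᴴ * B)).trace.re ≤ (Bᴴ * B).trace.re := by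
  have hpos := re_trace_mul_conjTranspose_nonneg ((1 - Φ) * B * (1 - Ψ))
  have hΦc := hΦ.compl
  have hΨc := hΨ.compl
  have hexp : (1 - Φ) * B * (1 - Ψ) = B - Φ * B - B * Ψ := by
    rw [Matrix.sub_mul, Matrix.mul_sub, Matrix.sub_mul, Matrix.sub_mul _ _ Ψ, hB]
    simp
  have htr : ((1 - Φ) * B * (1 - Ψ) * ((1 - Φ) * B * (1 - Ψ))ᴴ).trace =
      ((1 - Φ) * B * (1 - Ψ) * Bᴴ).trace := by
    rw [Matrix.conjTranspose_mul, Matrix.conjTranspose_mul, hΦc.conjTranspose_eq,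
      hΨc.conjTranspose_eq, ← Matrix.mul_assoc, ← Matrix.mul_assoc,
      Matrix.mul_assoc _ (1 - Ψ) (1 - Ψ), hΨc.mul_self, Matrix.trace_mul_comm,
      ← Matrix.mul_assoc, ← Matrix.mul_assoc, ← Matrix.mul_assoc, hΦc.mul_self]
  have h1 : (B * Bᴴ).trace = (Bᴴ * B).trace := Matrix.trace_mul_comm _ _
  have h2 : (B * Ψ * Bᴴ).trace = (Ψ * (Bᴴ * B)).trace := by
    rw [Matrix.mul_assoc, Matrix.trace_mul_comm, Matrix.mul_assoc]
  rw [htr, hexp, Matrix.sub_mul, Matrix.sub_mul, Matrix.trace_sub, Matrix.trace_sub, h1, h2,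
    Matrix.mul_assoc, Complex.sub_re, Complex.sub_re] at hpos
  linarith

/-- If `(L, R)` is `T`-independent, its preimages under `g`, `h` are independent for the scaled
Kraus operators. -/
lemma TIndep.mul_mul_eq_zero {m n r : ℕ} {A : Fin r → Matrix (Fin m) (Fin n) ℂ}
    {L : Submodule ℂ (Fin m → ℂ)} {R : Submodule ℂ (Fin n → ℂ)} (hLR : TIndep A L R)
    {g Φ : Matrix (Fin m) (Fin m) ℂ} {h Ψ : Matrix (Fin n) (Fin n) ℂ}
    (hΦ : IsOrthProj Φ (L.comap (Matrix.toLin' g)))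
    (hΨ : IsOrthProj Ψ (R.comap (Matrix.toLin' h))) (i : Fin r) :
    Φ * (gᴴ * A i * h) * Ψ = 0 := by
  refine Matrix.ext_of_mulVec_single fun b => funext fun a => ?_
  have hz := hLR i (h *ᵥ (Ψ *ᵥ Pi.single b 1)) (hΨ.mulVec_mem _)
    (g *ᵥ (Φ *ᵥ Pi.single a 1)) (hΦ.mulVec_mem _)
  rw [Matrix.mulVec_mulVec, Matrix.star_mulVec, Matrix.conjTranspose_mul, hΦ.conjTranspose_eq,
    ← Matrix.dotProduct_mulVec, Pi.star_single, star_one, single_one_dotProduct] at hz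
  simpa only [Matrix.mulVec_mulVec, Matrix.mul_assoc, Matrix.zero_mulVec, Pi.zero_apply] using hz

/-- Proposition (scalability implies approximate rank-nondecreasingness): if `T` has an
`ε`-`(I_n → Q, I_m → P)`-scaling by upper triangular matrices, then
`|Tr Q − Tr P| ≤ (√n + √m)ε` and every `T`-independent pair satisfies the rank inequality up to
`(√n + √m)ε`. -/
theorem stmt14 {n m r : ℕ} (A : Fin r → Matrix (Fin m) (Fin n) ℂ)
    (p : Fin n → ℝ) (q : Fin m → ℝ)
    (hp : Antitone p) (hp0 : ∀ j, 0 ≤ p j) (hq : Antitone q) (hq0 : ∀ i, 0 ≤ q i)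
    (ε : ℝ) (hε : 0 < ε)
    (g : Matrix (Fin m) (Fin m) ℂ) (h : Matrix (Fin n) (Fin n) ℂ)
    (hg : IsUnit g.det) (hgu : UT g) (hh : IsUnit h.det) (hhu : UT h)
    (hsc1 : frob (gᴴ * cpMap A (h * hᴴ) * g - Matrix.diagonal (fun i => (q i : ℂ))) ≤ ε)
    (hsc2 : frob (hᴴ * cpDual A (g * gᴴ) * h - Matrix.diagonal (fun j => (p j : ℂ))) ≤ ε) :
    |(∑ i, q i) - ∑ j, p j| ≤ (Real.sqrt n + Real.sqrt m) * ε ∧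
    ∀ L : Submodule ℂ (Fin m → ℂ), ∀ R : Submodule ℂ (Fin n → ℂ), TIndep A L R →
      (∑ i : Fin m, delta q i * (Module.finrank ℂ ↥(coordSub m ((i : ℕ) + 1) ⊓ L) : ℝ)) +
        (∑ j : Fin n, delta p j * (Module.finrank ℂ ↥(coordSub n ((j : ℕ) + 1) ⊓ R) : ℝ))
        ≤ (∑ j, p j) + (Real.sqrt n + Real.sqrt m) * ε := by
  set X := gᴴ * cpMap A (h * hᴴ) * g with hX
  set Y := hᴴ * cpDual A (g * gᴴ) * h with hY
  set Q := Matrix.diagonal fun i => (q i : ℂ) with hQ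
  set P := Matrix.diagonal fun j => (p j : ℂ) with hP
  rw [conjTranspose_mul_cpMap_mul] at hX
  rw [conjTranspose_mul_cpDual_mul] at hY
  have hbound : ∀ {k : ℕ} {Φ M : Matrix (Fin k) (Fin k) ℂ} {S : Submodule ℂ (Fin k → ℂ)},
      IsOrthProj Φ S → frob M ≤ ε → |(Φ * M).trace.re| ≤ Real.sqrt k * ε := fun hΦ hM =>
    (abs_re_trace_mul_le _ _).trans
      (mul_le_mul hΦ.frob_le hM (Real.sqrt_nonneg _) (Real.sqrt_nonneg _))
  have htop : ∀ k : ℕ, IsOrthProj (1 : Matrix (Fin k) (Fin k) ℂ) ⊤ := fun k =>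
    ⟨Matrix.conjTranspose_one, fun _ => trivial, fun x _ => Matrix.one_mulVec x⟩
  have hXY : X.trace = Y.trace := by
    rw [hX, hY, Matrix.trace_sum, Matrix.trace_sum]
    exact Finset.sum_congr rfl fun i _ => Matrix.trace_mul_comm _ _
  have hQt : Q.trace.re = ∑ i, q i := by simp [hQ, Matrix.trace]
  have hPt : P.trace.re = ∑ j, p j := by simp [hP, Matrix.trace]
  refine ⟨?_, fun L R hLR => ?_⟩
  · have h1 := abs_le.1 (hbound (htop m) hsc1)
    have h2 := abs_le.1 (hbound (htop n) hsc2)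
    rw [one_mul, Matrix.trace_sub, Complex.sub_re, hQt, hXY] at h1
    rw [one_mul, Matrix.trace_sub, Complex.sub_re, hPt] at h2
    rw [abs_le]
    constructor <;> linarith [h1.1, h1.2, h2.1, h2.2]
  · obtain ⟨Φ, hΦ⟩ := exists_isOrthProj (L.comap (Matrix.toLin' g))
    obtain ⟨Ψ, hΨ⟩ := exists_isOrthProj (R.comap (Matrix.toLin' h))
    have hq' := hΦ.sum_delta_mul_finrank_le hq hq0
    have hp' := hΨ.sum_delta_mul_finrank_le hp hp0
    simp only [finrank_coordSub_inf_comap hg hgu] at hq'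
    simp only [finrank_coordSub_inf_comap hh hhu] at hp'
    have hmain : (Φ * X).trace.re + (Ψ * Y).trace.re ≤ Y.trace.re := by
      simp only [hX, hY, Matrix.mul_sum, Matrix.trace_sum, Complex.re_sum,
        ← Finset.sum_add_distrib]
      exact Finset.sum_le_sum fun i _ => hΦ.re_trace_add_le hΨ (hLR.mul_mul_eq_zero hΦ hΨ i)
    have h1 := abs_le.1 (hbound hΦ hsc1)
    have h2 := abs_le.1 (hbound hΨ.compl hsc2)
    rw [Matrix.mul_sub, Matrix.trace_sub, Complex.sub_re] at h1
    rw [Matrix.mul_sub, Matrix.sub_mul, Matrix.sub_mul, one_mul, one_mul] at h2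
    simp only [Matrix.trace_sub, Complex.sub_re, hPt] at h2
    linarith [h1.1, h2.2]
end
end

section
/- Let u_1, …, u_n ∈ ℂ^m be nonzero vectors, p ∈ ℝ^n_{≥0}, and let Q be an m×m positive-definite Hermitian matrix with nonincreasing eigenvalues q_1 ≥ … ≥ q_m > 0. Then (u_1, …, u_n) can be approximately put in Q-isotropic position with respect to p if and only if Σ_{j=1}^n p_j = Σ_{i=1}^m q_i and for every subset J ⊆ [n]: Σ_{j∈J} p_j ≤ Σ_{i=1}^{d(J)} q_i, where d(J) = dim span{u_j : j ∈ J}. -/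
open Matrix BigOperators

noncomputable section

/-- The squared Euclidean norm of a complex vector. -/
def sqNorm {m : ℕ} (w : Fin m → ℂ) : ℝ := ∑ a, Complex.normSq (w a)

/-- The matrix `∑ i, p i • v i (v i)ᴴ / ‖v i‖²`. -/
def isoMatrix {m n : ℕ} (p : Fin n → ℝ) (v : Fin n → Fin m → ℂ) : Matrix (Fin m) (Fin m) ℂ :=
  ∑ i, ((p i / sqNorm (v i) : ℝ) : ℂ) • Matrix.vecMulVec (v i) (star (v i))

lemma sqNorm_nonneg {m : ℕ} (w : Fin m → ℂ) : 0 ≤ sqNorm w :=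
  Finset.sum_nonneg fun _ _ => Complex.normSq_nonneg _

lemma normSq_le_sqNorm {m : ℕ} (w : Fin m → ℂ) (a : Fin m) : Complex.normSq (w a) ≤ sqNorm w :=
  Finset.single_le_sum (f := fun a => Complex.normSq (w a))
    (fun _ _ => Complex.normSq_nonneg _) (Finset.mem_univ a)

lemma sqNorm_pos {m : ℕ} {w : Fin m → ℂ} (hw : w ≠ 0) : 0 < sqNorm w := by
  obtain ⟨a, ha⟩ := Function.ne_iff.mp hw
  exact (Complex.normSq_pos.mpr ha).trans_le (normSq_le_sqNorm w a)

lemma sqNorm_eq_dotProduct {m : ℕ} (w : Fin m → ℂ) : (sqNorm w : ℂ) = star w ⬝ᵥ w := by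
  simp [sqNorm, dotProduct, Complex.normSq_eq_conj_mul_self]

lemma isoMatrix_apply {m n : ℕ} (p : Fin n → ℝ) (v : Fin n → Fin m → ℂ) (a b : Fin m) :
    isoMatrix p v a b = ∑ i, ((p i / sqNorm (v i) : ℝ) : ℂ) * (v i a * star (v i b)) := by
  simp [isoMatrix, Matrix.sum_apply, Matrix.vecMulVec_apply]

lemma sqNorm_unitary_mulVec {m : ℕ} {U : Matrix (Fin m) (Fin m) ℂ}
    (hU : U ∈ Matrix.unitaryGroup (Fin m) ℂ) (w : Fin m → ℂ) :
    sqNorm (U *ᵥ w) = sqNorm w := by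
  have h : (sqNorm (U *ᵥ w) : ℂ) = sqNorm w := by
    rw [sqNorm_eq_dotProduct, sqNorm_eq_dotProduct, Matrix.star_mulVec, Matrix.dotProduct_mulVec,
      Matrix.vecMul_vecMul, ← Matrix.star_eq_conjTranspose, Matrix.mem_unitaryGroup_iff'.mp hU,
      Matrix.vecMul_one]
  exact_mod_cast h

lemma isoMatrix_unitary {m n : ℕ} {U : Matrix (Fin m) (Fin m) ℂ}
    (hU : U ∈ Matrix.unitaryGroup (Fin m) ℂ) (p : Fin n → ℝ) (v : Fin n → Fin m → ℂ) :
    isoMatrix p (fun i => U *ᵥ v i) = U * isoMatrix p v * Uᴴ := by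
  simp only [isoMatrix, sqNorm_unitary_mulVec hU, Matrix.mul_sum, Matrix.sum_mul]
  refine Finset.sum_congr rfl fun i _ => ?_
  rw [Matrix.mul_smul, Matrix.smul_mul, Matrix.mul_vecMulVec, Matrix.vecMulVec_mul,
    Matrix.star_mulVec]

lemma frob_unitary_conj {m : ℕ} {U : Matrix (Fin m) (Fin m) ℂ}
    (hU : U ∈ Matrix.unitaryGroup (Fin m) ℂ) (D : Matrix (Fin m) (Fin m) ℂ) :
    frob (U * D * Uᴴ) = frob D := by
  have h : Uᴴ * U = 1 := Matrix.mem_unitaryGroup_iff'.mp hU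
  have h2 : U * D * Uᴴ * (U * D * Uᴴ)ᴴ = U * (D * Dᴴ) * Uᴴ := by
    simp only [Matrix.conjTranspose_mul, Matrix.conjTranspose_conjTranspose]
    calc _ = U * D * (Uᴴ * U) * (Dᴴ * Uᴴ) := by simp only [Matrix.mul_assoc]
      _ = _ := by rw [h]; simp only [Matrix.mul_assoc, Matrix.one_mul]
  rw [frob, frob, h2, Matrix.trace_mul_comm, ← Matrix.mul_assoc, h, Matrix.one_mul]

lemma frob_eq_sqrt_sum {m : ℕ} (D : Matrix (Fin m) (Fin m) ℂ) :
    frob D = Real.sqrt (∑ a, ∑ b, Complex.normSq (D a b)) := by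
  simp [frob, Matrix.trace, Matrix.mul_apply, Complex.mul_conj]

lemma norm_apply_le_frob {m : ℕ} (D : Matrix (Fin m) (Fin m) ℂ) (a b : Fin m) :
    ‖D a b‖ ≤ frob D := by
  rw [frob_eq_sqrt_sum]
  refine Real.le_sqrt_of_sq_le ?_
  rw [← Complex.normSq_eq_norm_sq]
  calc _ ≤ ∑ b, Complex.normSq (D a b) := normSq_le_sqNorm (D a) b
    _ ≤ _ := Finset.single_le_sum (f := fun a => ∑ b, Complex.normSq (D a b))
      (fun a _ => sqNorm_nonneg (D a)) (Finset.mem_univ a)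

lemma frob_le_of_norm_le {m : ℕ} {D : Matrix (Fin m) (Fin m) ℂ} {η : ℝ} (hη : 0 ≤ η)
    (hD : ∀ a b, ‖D a b‖ ≤ η) : frob D ≤ m * η := by
  rw [frob_eq_sqrt_sum, Real.sqrt_le_left (by positivity)]
  calc _ ≤ ∑ _a : Fin m, ∑ _b : Fin m, η ^ 2 := by
        refine Finset.sum_le_sum fun a _ => Finset.sum_le_sum fun b _ => ?_
        rw [Complex.normSq_eq_norm_sq]
        exact pow_le_pow_left₀ (norm_nonneg _) (hD a b) 2
    _ = _ := by simp; ring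

lemma approxIso_iff_isoMatrix {m n : ℕ} (u : Fin n → Fin m → ℂ) (p : Fin n → ℝ)
    (Q : Matrix (Fin m) (Fin m) ℂ) :
    approxIso u p Q ↔ ∀ ε : ℝ, 0 < ε → ∃ B : Matrix (Fin m) (Fin m) ℂ, IsUnit B.det ∧
      frob (isoMatrix p (fun i => B *ᵥ u i) - Q) ≤ ε := Iff.rfl

lemma approxIso.unitary_conj {m n : ℕ} {u : Fin n → Fin m → ℂ} {p : Fin n → ℝ}
    {Q U : Matrix (Fin m) (Fin m) ℂ} (hU : U ∈ Matrix.unitaryGroup (Fin m) ℂ)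
    (h : approxIso u p Q) : approxIso u p (U * Q * Uᴴ) := by
  rw [approxIso_iff_isoMatrix] at h ⊢
  intro ε hε
  obtain ⟨B, hB, hB'⟩ := h ε hε
  refine ⟨U * B, ?_, ?_⟩
  · rw [Matrix.det_mul]
    exact (Matrix.isUnit_det_of_left_inverse (Matrix.mem_unitaryGroup_iff'.mp hU)).mul hB
  · simp only [← Matrix.mulVec_mulVec]
    rwa [isoMatrix_unitary hU p fun i => B *ᵥ u i, ← Matrix.sub_mul, ← Matrix.mul_sub,
      frob_unitary_conj hU]

lemma approxIso_unitary_conj_iff {m n : ℕ} {u : Fin n → Fin m → ℂ} {p : Fin n → ℝ}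
    {Q U : Matrix (Fin m) (Fin m) ℂ} (hU : U ∈ Matrix.unitaryGroup (Fin m) ℂ) :
    approxIso u p (U * Q * Uᴴ) ↔ approxIso u p Q := by
  refine ⟨fun h => ?_, fun h => h.unitary_conj hU⟩
  have h1 : Uᴴ * U = 1 := Matrix.mem_unitaryGroup_iff'.mp hU
  have h2 := h.unitary_conj (Unitary.star_mem hU)
  rw [Matrix.star_eq_conjTranspose, Matrix.conjTranspose_conjTranspose] at h2
  have h3 : Uᴴ * (U * Q * Uᴴ) * U = Q := by
    calc _ = (Uᴴ * U) * Q * (Uᴴ * U) := by simp only [Matrix.mul_assoc]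
      _ = Q := by rw [h1, Matrix.one_mul, Matrix.mul_one]
  rwa [h3] at h2

lemma sum_mul_le_sum_filter_lt {m : ℕ} {q c : Fin m → ℝ} (hqa : Antitone q) (hq0 : ∀ i, 0 ≤ q i)
    (hc0 : ∀ i, 0 ≤ c i) (hc1 : ∀ i, c i ≤ 1) {d : ℕ} (hd : d ≤ m) (hc : ∑ i, c i ≤ d) :
    ∑ i, q i * c i ≤ ∑ i ∈ Finset.univ.filter (fun i : Fin m => (i : ℕ) < d), q i := by
  obtain ⟨θ, hθ0, hlt, hge⟩ : ∃ θ : ℝ, 0 ≤ θ ∧ (∀ i : Fin m, (i : ℕ) < d → θ ≤ q i) ∧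
      ∀ i : Fin m, d ≤ (i : ℕ) → q i ≤ θ := by
    by_cases h : d < m
    · exact ⟨q ⟨d, h⟩, hq0 _, fun i hi => hqa (Fin.le_def.mpr hi.le),
        fun i hi => hqa (Fin.le_def.mpr hi)⟩
    · exact ⟨0, le_rfl, fun i _ => hq0 i, fun i hi => absurd i.2 (by omega)⟩
  have hcard : ∑ i : Fin m, (if (i : ℕ) < d then (1 : ℝ) else 0) = d := by
    rw [Finset.sum_boole, Fin.card_filter_val_lt, min_eq_right hd]
  have hpt : ∀ i : Fin m,
      q i * c i + θ * ((if (i : ℕ) < d then 1 else 0) - c i) ≤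
        if (i : ℕ) < d then q i else 0 := by
    intro i
    split_ifs with h
    · nlinarith [hlt i h, hc1 i]
    · nlinarith [hge i (not_lt.mp h), hc0 i]
  have hsum := Finset.sum_le_sum fun i (_ : i ∈ Finset.univ) => hpt i
  rw [Finset.sum_add_distrib, ← Finset.mul_sum, Finset.sum_sub_distrib, hcard] at hsum
  rw [Finset.sum_filter]
  nlinarith

lemma exists_orthonormal_frame {m : ℕ} (W : Submodule ℂ (Fin m → ℂ)) :
    ∃ E : Fin (Module.finrank ℂ W) → Fin m → ℂ,
      (∀ x ∈ W, ∑ k, Complex.normSq (star (E k) ⬝ᵥ x) = sqNorm x) ∧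
      (∀ x, ∑ k, Complex.normSq (star (E k) ⬝ᵥ x) ≤ sqNorm x) ∧
      ∀ k, sqNorm (E k) = 1 := by
  let L : (Fin m → ℂ) ≃ₗ[ℂ] EuclideanSpace ℂ (Fin m) := (WithLp.linearEquiv 2 ℂ (Fin m → ℂ)).symm
  let W' : Submodule ℂ (EuclideanSpace ℂ (Fin m)) := W.map (L : (Fin m → ℂ) →ₗ[ℂ] _)
  have hfin : Module.finrank ℂ W' = Module.finrank ℂ W := LinearEquiv.finrank_map_eq L W
  let e := (stdOrthonormalBasis ℂ W').reindex (finCongr hfin)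
  have hnorm : ∀ x : EuclideanSpace ℂ (Fin m), sqNorm x.ofLp = ‖x‖ ^ 2 := by
    intro x
    simp [EuclideanSpace.norm_sq_eq, sqNorm, Complex.normSq_eq_norm_sq]
  have hinner : ∀ x y : EuclideanSpace ℂ (Fin m),
      Complex.normSq (star x.ofLp ⬝ᵥ y.ofLp) = ‖inner ℂ x y‖ ^ 2 := by
    intro x y
    rw [EuclideanSpace.inner_eq_star_dotProduct, Complex.normSq_eq_norm_sq, dotProduct_comm]
  have he : Orthonormal ℂ (fun k => (e k : EuclideanSpace ℂ (Fin m))) :=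
    e.orthonormal.comp_linearIsometry W'.subtypeₗᵢ
  refine ⟨fun k => (e k : EuclideanSpace ℂ (Fin m)).ofLp, fun x hx => ?_, fun x => ?_, fun k => ?_⟩
  · have hx' : L x ∈ W' := Submodule.mem_map_of_mem hx
    have h := e.sum_sq_norm_inner_right ⟨L x, hx'⟩
    calc _ = ∑ k, ‖inner ℂ (e k : EuclideanSpace ℂ (Fin m)) (L x)‖ ^ 2 :=
          Finset.sum_congr rfl fun k _ => hinner _ (L x)
      _ = ‖L x‖ ^ 2 := h
      _ = sqNorm x := (hnorm (L x)).symm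
  · calc _ = ∑ k, ‖inner ℂ (e k : EuclideanSpace ℂ (Fin m)) (L x)‖ ^ 2 :=
          Finset.sum_congr rfl fun k _ => hinner _ (L x)
      _ ≤ ‖L x‖ ^ 2 := he.sum_inner_products_le (L x)
      _ = sqNorm x := (hnorm (L x)).symm
  · rw [hnorm, he.1 k, one_pow]

lemma norm_star_dotProduct_mulVec_le {m : ℕ} {D : Matrix (Fin m) (Fin m) ℂ} {ε : ℝ}
    (hD : ∀ a b, ‖D a b‖ ≤ ε) {x : Fin m → ℂ} (hx : sqNorm x = 1) :
    ‖star x ⬝ᵥ D *ᵥ x‖ ≤ m ^ 2 * ε := by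
  have hx1 : ∀ a, ‖x a‖ ≤ 1 := by
    intro a
    have := normSq_le_sqNorm x a
    rw [hx, Complex.normSq_eq_norm_sq] at this
    nlinarith [norm_nonneg (x a)]
  have hrow : ∀ a, ‖(D *ᵥ x) a‖ ≤ m * ε := by
    intro a
    calc ‖∑ b, D a b * x b‖ ≤ ∑ _b : Fin m, ε := by
          refine norm_sum_le_of_le _ fun b _ => ?_
          rw [norm_mul]
          nlinarith [norm_nonneg (x b), norm_nonneg (D a b), hx1 b, hD a b]
      _ = m * ε := by simp
  calc ‖∑ a, star (x a) * (D *ᵥ x) a‖ ≤ ∑ _a : Fin m, m * ε := by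
        refine norm_sum_le_of_le _ fun a _ => ?_
        rw [norm_mul, norm_star]
        nlinarith [norm_nonneg (x a), norm_nonneg ((D *ᵥ x) a), hx1 a, hrow a]
    _ = m ^ 2 * ε := by simp; ring

lemma star_dotProduct_isoMatrix_mulVec {m n : ℕ} (p : Fin n → ℝ) (v : Fin n → Fin m → ℂ)
    (x : Fin m → ℂ) :
    star x ⬝ᵥ isoMatrix p v *ᵥ x =
      ((∑ i, p i / sqNorm (v i) * Complex.normSq (star x ⬝ᵥ v i) : ℝ) : ℂ) := by
  have h : ∀ w : Fin m → ℂ, star w ⬝ᵥ x = star (star x ⬝ᵥ w) := by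
    intro w
    rw [Matrix.star_dotProduct]
  simp only [isoMatrix, Matrix.sum_mulVec, dotProduct_sum, Matrix.smul_mulVec,
    dotProduct_smul, Matrix.vecMulVec_mulVec, h]
  push_cast
  refine Finset.sum_congr rfl fun i _ => ?_
  rw [Complex.normSq_eq_conj_mul_self, op_smul_eq_smul, smul_eq_mul, smul_eq_mul, mul_comm (star _)]
  simp [mul_comm]

lemma star_dotProduct_diagonal_mulVec {m : ℕ} (q : Fin m → ℝ) (x : Fin m → ℂ) :
    star x ⬝ᵥ Matrix.diagonal (fun i => (q i : ℂ)) *ᵥ x =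
      ((∑ a, q a * Complex.normSq (x a) : ℝ) : ℂ) := by
  simp only [dotProduct, Matrix.mulVec_diagonal, Pi.star_apply]
  push_cast
  refine Finset.sum_congr rfl fun a _ => ?_
  simp [Complex.normSq_eq_conj_mul_self]
  ring

lemma sum_le_sum_filter_add {m n : ℕ} {v : Fin n → Fin m → ℂ} (hv : ∀ i, v i ≠ 0)
    {p : Fin n → ℝ} (hp : ∀ i, 0 ≤ p i) {q : Fin m → ℝ} (hqa : Antitone q) (hq0 : ∀ i, 0 ≤ q i)
    {ε : ℝ} (hε : 0 ≤ ε)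
    (hD : ∀ a b, ‖(isoMatrix p v - Matrix.diagonal (fun i => (q i : ℂ))) a b‖ ≤ ε)
    (J : Finset (Fin n)) (W : Submodule ℂ (Fin m → ℂ)) (hW : ∀ i ∈ J, v i ∈ W) :
    ∑ j ∈ J, p j ≤
      ∑ i ∈ Finset.univ.filter (fun i : Fin m => (i : ℕ) < Module.finrank ℂ W), q i +
        m ^ 3 * ε := by
  obtain ⟨E, hE1, hE2, hE3⟩ := exists_orthonormal_frame W
  have hd : Module.finrank ℂ W ≤ m := by simpa using W.finrank_le
  set c : Fin m → ℝ := fun a => ∑ k, Complex.normSq (E k a) with hc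
  have hc1 : ∀ a, c a ≤ 1 := by
    intro a
    simpa [sqNorm, Pi.single_apply, apply_ite] using hE2 (Pi.single a 1)
  have hcs : ∑ a, c a = Module.finrank ℂ W := by
    rw [hc, Finset.sum_comm]
    change ∑ k, sqNorm (E k) = _
    simp [hE3]
  have hky := sum_mul_le_sum_filter_lt hqa hq0
    (fun a => Finset.sum_nonneg fun k _ => Complex.normSq_nonneg (E k a)) hc1 hd hcs.le
  have hlow : ∑ j ∈ J, p j ≤
      ∑ k, ∑ i, p i / sqNorm (v i) * Complex.normSq (star (E k) ⬝ᵥ v i) := by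
    rw [Finset.sum_comm]
    simp only [← Finset.mul_sum]
    calc ∑ j ∈ J, p j
        = ∑ j ∈ J, p j / sqNorm (v j) * ∑ k, Complex.normSq (star (E k) ⬝ᵥ v j) := by
          refine Finset.sum_congr rfl fun j hj => ?_
          rw [hE1 _ (hW j hj), div_mul_cancel₀ _ (sqNorm_pos (hv j)).ne']
      _ ≤ _ := Finset.sum_le_sum_of_subset_of_nonneg (Finset.subset_univ J) fun j _ _ =>
          mul_nonneg (div_nonneg (hp j) (sqNorm_nonneg _))
            (Finset.sum_nonneg fun k _ => Complex.normSq_nonneg _)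
  have hk : ∀ k, ∑ i, p i / sqNorm (v i) * Complex.normSq (star (E k) ⬝ᵥ v i) ≤
      ∑ a, q a * Complex.normSq (E k a) + m ^ 2 * ε := by
    intro k
    have h := norm_star_dotProduct_mulVec_le hD (hE3 k)
    rw [Matrix.sub_mulVec, dotProduct_sub, star_dotProduct_isoMatrix_mulVec,
      star_dotProduct_diagonal_mulVec, ← Complex.ofReal_sub, Complex.norm_real] at h
    linarith [(le_abs_self _).trans h]
  have hup := Finset.sum_le_sum fun k (_ : k ∈ Finset.univ) => hk k
  rw [Finset.sum_add_distrib] at hup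
  have hcomm : ∑ k, ∑ a, q a * Complex.normSq (E k a) = ∑ a, q a * c a := by
    rw [Finset.sum_comm]
    simp only [hc, Finset.mul_sum]
  have hdm : (Module.finrank ℂ W : ℝ) ≤ m := by exact_mod_cast hd
  have hlast : ∑ _k : Fin (Module.finrank ℂ W), (m : ℝ) ^ 2 * ε ≤ m ^ 3 * ε := by
    simp only [Finset.sum_const, Finset.card_univ, Fintype.card_fin, nsmul_eq_mul]
    calc _ ≤ (m : ℝ) * (m ^ 2 * ε) := by gcongr
      _ = _ := by ring
  linarith

lemma trace_isoMatrix {m n : ℕ} {v : Fin n → Fin m → ℂ} (hv : ∀ i, v i ≠ 0) (p : Fin n → ℝ) :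
    (isoMatrix p v).trace = ((∑ i, p i : ℝ) : ℂ) := by
  rw [isoMatrix, Matrix.trace_sum]
  rw [Complex.ofReal_sum]
  refine Finset.sum_congr rfl fun i _ => ?_
  rw [Matrix.trace_smul, Matrix.trace_vecMulVec, dotProduct_comm, ← sqNorm_eq_dotProduct,
    smul_eq_mul, ← Complex.ofReal_mul, div_mul_cancel₀ _ (sqNorm_pos (hv i)).ne']

lemma mulVec_ne_zero_of_isUnit_det {m : ℕ} {B : Matrix (Fin m) (Fin m) ℂ} (hB : IsUnit B.det)
    {x : Fin m → ℂ} (hx : x ≠ 0) : B *ᵥ x ≠ 0 := fun h =>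
  hx (Matrix.eq_zero_of_mulVec_eq_zero hB.ne_zero h)

theorem approxIso.sum_eq_and_sum_le {m n : ℕ} {u : Fin n → Fin m → ℂ} (hu : ∀ i, u i ≠ 0)
    {p : Fin n → ℝ} (hp : ∀ i, 0 ≤ p i) {q : Fin m → ℝ} (hqa : Antitone q) (hq0 : ∀ i, 0 ≤ q i)
    (h : approxIso u p (Matrix.diagonal fun i => (q i : ℂ))) :
    (∑ j, p j = ∑ i, q i) ∧
      ∀ J : Finset (Fin n), ∑ j ∈ J, p j ≤
        ∑ i ∈ Finset.univ.filter
            (fun i : Fin m =>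
              (i : ℕ) < Module.finrank ℂ (Submodule.span ℂ (u '' (J : Set (Fin n))))),
          q i := by
  rw [approxIso_iff_isoMatrix] at h
  refine ⟨eq_of_abs_sub_le_all fun ε hε => ?_, fun J => le_of_forall_pos_le_add fun ε hε => ?_⟩
  · obtain ⟨B, hB, hBε⟩ := h (ε / (m + 1)) (by positivity)
    have hv := fun i => mulVec_ne_zero_of_isUnit_det hB (hu i)
    have htr : (isoMatrix p (fun i => B *ᵥ u i) - Matrix.diagonal fun i => (q i : ℂ)).trace =
        ((∑ j, p j - ∑ i, q i : ℝ) : ℂ) := by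
      rw [Matrix.trace_sub, trace_isoMatrix hv, Matrix.trace_diagonal]
      push_cast
      rfl
    have hle : ‖(isoMatrix p (fun i => B *ᵥ u i) -
        Matrix.diagonal fun i => (q i : ℂ)).trace‖ ≤ ∑ _a : Fin m, ε / (m + 1) :=
      norm_sum_le_of_le _ fun a _ => (norm_apply_le_frob _ a a).trans hBε
    rw [htr, Complex.norm_real, Real.norm_eq_abs] at hle
    refine hle.trans ?_
    simp only [Finset.sum_const, Finset.card_univ, Fintype.card_fin, nsmul_eq_mul]
    rw [mul_div_assoc', div_le_iff₀ (by positivity)]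
    nlinarith
  · obtain ⟨B, hB, hBε⟩ := h (ε / (m ^ 3 + 1)) (by positivity)
    have hv := fun i => mulVec_ne_zero_of_isUnit_det hB (hu i)
    set S := Submodule.span ℂ (u '' (J : Set (Fin n)))
    have hmem : ∀ i ∈ J, B *ᵥ u i ∈ S.map (Matrix.toLin' B) := fun i hi =>
      ⟨u i, Submodule.subset_span ⟨i, hi, rfl⟩, Matrix.toLin'_apply B (u i)⟩
    have hrank : Module.finrank ℂ (S.map (Matrix.toLin' B)) = Module.finrank ℂ S :=
      (Submodule.equivMapOfInjective _ (LinearMap.ker_eq_bot.mp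
        ((Matrix.ker_toLin'_eq_bot_iff).mpr fun x hx => by
          by_contra hx0
          exact mulVec_ne_zero_of_isUnit_det hB hx0 hx)) S).finrank_eq.symm
    have key := sum_le_sum_filter_add hv hp hqa hq0 (by positivity)
      (fun a b => (norm_apply_le_frob _ a b).trans hBε) J _ hmem
    rw [hrank] at key
    refine key.trans ?_
    gcongr
    rw [mul_div_assoc', div_le_iff₀ (by positivity)]
    nlinarith

/-- Greedy choice of a basis: processing the vectors in increasing order of the weights `a` gives
a basis `u ∘ j` of the span whose weighted cost is a lower bound for that of `p`. -/
lemma exists_greedy_basis {V ι : Type*} [AddCommGroup V] [Module ℂ V] (u : ι → V) (p a : ι → ℝ)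
    (q : ℕ → ℝ)
    (hF : ∀ J : Finset ι, ∑ j ∈ J, p j ≤
      ∑ i ∈ Finset.range (Module.finrank ℂ (Submodule.span ℂ (u '' (J : Set ι)))), q i)
    (S : Finset ι) :
    ∃ (k : ℕ) (j : Fin k → ι), LinearIndependent ℂ (u ∘ j) ∧
      Submodule.span ℂ (Set.range (u ∘ j)) = Submodule.span ℂ (u '' (S : Set ι)) ∧
      ∀ t, (∀ i ∈ S, a i ≤ t) →
        ∑ i ∈ S, p i * (t - a i) ≤ ∑ i : Fin k, q i * (t - a (j i)) := by
  classical
  induction S using Finset.induction_on_max_value a with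
  | empty => exact ⟨0, Fin.elim0, linearIndependent_empty_type, by simp, by simp⟩
  | insert x S hx hmax ih =>
    obtain ⟨k, j, hli, hspan, hle⟩ := ih
    have hstep : ∀ t, a x ≤ t → ∑ i ∈ insert x S, p i * (t - a i) ≤
        ∑ i : Fin k, q i * (a x - a (j i)) + (t - a x) * ∑ i ∈ Finset.range
          (Module.finrank ℂ (Submodule.span ℂ (u '' ((insert x S : Finset ι) : Set ι)))), q i := by
      intro t ht
      have h1 : ∑ i ∈ insert x S, p i * (t - a i) =
          ∑ i ∈ S, p i * (a x - a i) + (t - a x) * ∑ i ∈ insert x S, p i := by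
        rw [Finset.sum_insert hx, Finset.sum_insert hx, mul_add, Finset.mul_sum, add_left_comm,
          ← Finset.sum_add_distrib, mul_comm]
        exact congrArg _ (Finset.sum_congr rfl fun i _ => by ring)
      rw [h1]
      exact add_le_add (hle _ hmax) (mul_le_mul_of_nonneg_left (hF _) (by linarith))
    by_cases hmem : u x ∈ Submodule.span ℂ (Set.range (u ∘ j))
    · have hspan' : Submodule.span ℂ (Set.range (u ∘ j)) =
          Submodule.span ℂ (u '' ((insert x S : Finset ι) : Set ι)) := by
        rw [Finset.coe_insert, Set.image_insert_eq, hspan, eq_comm]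
        exact Submodule.span_insert_eq_span (hspan ▸ hmem)
      refine ⟨k, j, hli, hspan', fun t ht => (hstep t (ht x (Finset.mem_insert_self x S))).trans ?_⟩
      rw [← hspan', finrank_span_eq_card hli, Fintype.card_fin, Finset.sum_range, Finset.mul_sum,
        ← Finset.sum_add_distrib]
      exact (Finset.sum_congr rfl fun i _ => by ring).le
    · have hcomp : u ∘ (Fin.snoc j x : Fin (k + 1) → ι) = Fin.snoc (u ∘ j) (u x) :=
        Fin.comp_snoc u j x
      have hli' : LinearIndependent ℂ (u ∘ (Fin.snoc j x : Fin (k + 1) → ι)) := by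
        rw [hcomp]
        exact hli.finSnoc hmem
      have hspan' : Submodule.span ℂ (Set.range (u ∘ (Fin.snoc j x : Fin (k + 1) → ι))) =
          Submodule.span ℂ (u '' ((insert x S : Finset ι) : Set ι)) := by
        rw [hcomp, Fin.range_snoc, Finset.coe_insert, Set.image_insert_eq, Submodule.span_insert,
          Submodule.span_insert, hspan]
      refine ⟨k + 1, Fin.snoc j x, hli', hspan',
        fun t ht => (hstep t (ht x (Finset.mem_insert_self x S))).trans ?_⟩
      rw [← hspan', finrank_span_eq_card hli', Fintype.card_fin, Finset.sum_range_succ,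
        Finset.sum_range, mul_add, Finset.mul_sum, ← add_assoc, ← Finset.sum_add_distrib,
        Fin.sum_univ_castSucc]
      simp only [Fin.snoc_castSucc, Fin.snoc_last, Fin.val_castSucc, Fin.val_last]
      exact (congrArg₂ _ (Finset.sum_congr rfl fun i _ => by ring) (mul_comm _ _)).le

/-- A sequence on `Fin m`, extended by zero to `ℕ`. -/
def extendZero {m : ℕ} (q : Fin m → ℝ) (i : ℕ) : ℝ := if h : i < m then q ⟨i, h⟩ else 0

lemma extendZero_val {m : ℕ} (q : Fin m → ℝ) (i : Fin m) : extendZero q i = q i := by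
  simp [extendZero]

lemma extendZero_antitone {m : ℕ} {q : Fin m → ℝ} (hqa : Antitone q) (hq0 : ∀ i, 0 ≤ q i) :
    Antitone (extendZero q) := by
  intro i k hik
  unfold extendZero
  split_ifs with hk hi hi
  · exact hqa (Fin.mk_le_mk.mpr hik)
  · omega
  · exact hq0 _
  · exact le_rfl

lemma sum_range_extendZero {m d : ℕ} (q : Fin m → ℝ) (hd : d ≤ m) :
    ∑ i ∈ Finset.range d, extendZero q i =
      ∑ i ∈ Finset.univ.filter (fun i : Fin m => (i : ℕ) < d), q i := by
  rw [Finset.sum_filter]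
  have h : ∀ i : Fin m, (if (i : ℕ) < d then q i else 0) =
      (fun i : ℕ => if i < d then extendZero q i else 0) i := fun i => by
    simp [extendZero_val]
  rw [Finset.sum_congr rfl fun i _ => h i, 
    ← Finset.sum_range (fun i : ℕ => if i < d then extendZero q i else 0), ← Finset.sum_filter]
  refine Finset.sum_congr ?_ fun _ _ => rfl
  ext i
  simp only [Finset.mem_range, Finset.mem_filter]
  omega

lemma sum_mul_le_of_partial_sum_le {m : ℕ} {q : Fin m → ℝ} (hqa : Antitone q)
    (hq0 : ∀ i, 0 ≤ q i) {b : Fin m → ℝ} {C : ℝ}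
    (hC : ∀ (k : ℕ) (hk : k ≤ m), ∑ i : Fin k, b (Fin.castLE hk i) ≤ C) :
    ∑ i, q i * b i ≤ extendZero q 0 * C := by
  have hanti := extendZero_antitone hqa hq0
  have hb : ∀ k ≤ m, ∑ i ∈ Finset.range k, extendZero b i ≤ C := by
    intro k hk
    rw [Finset.sum_range]
    refine le_of_eq_of_le (Finset.sum_congr rfl fun i _ => ?_) (hC k hk)
    exact extendZero_val b (Fin.castLE hk i)
  have key : ∀ k ≤ m, ∑ i ∈ Finset.range k, extendZero q i * extendZero b i ≤
      extendZero q 0 * C - extendZero q k * (C - ∑ i ∈ Finset.range k, extendZero b i) := by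
    intro k
    induction k with
    | zero => simp
    | succ k ih =>
      intro hk
      have h1 := ih (by omega)
      have h2 := hb (k + 1) hk
      have h3 := hanti (Nat.le_succ k)
      rw [Finset.sum_range_succ] at h2 ⊢
      rw [Finset.sum_range_succ]
      nlinarith
  have hm := key m le_rfl
  rw [Finset.sum_range] at hm
  simpa [extendZero_val, extendZero] using hm

/-- The leading principal `k × k` submatrix. -/
def leadingSubmatrix {R : Type*} {m k : ℕ} (hk : k ≤ m) (A : Matrix (Fin m) (Fin m) R) :
    Matrix (Fin k) (Fin k) R :=
  A.submatrix (Fin.castLE hk) (Fin.castLE hk)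

/-- Finitely many invertible matrices can be simultaneously moved by left multiplication so that
all their leading principal minors are nonzero. -/
lemma exists_forall_leading_minor_ne_zero {m : ℕ} {X : Type*} [Fintype X]
    (A : X → Matrix (Fin m) (Fin m) ℂ) (hA : ∀ x, IsUnit (A x).det) :
    ∃ g : Matrix (Fin m) (Fin m) ℂ, ∀ x (k : ℕ) (hk : k ≤ m),
      (leadingSubmatrix hk (g * A x)).det ≠ 0 := by
  let P : X → Fin (m + 1) → MvPolynomial (Fin m × Fin m) ℂ := fun x k =>
    (leadingSubmatrix (Nat.lt_succ_iff.mp k.2)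
      (Matrix.mvPolynomialX (Fin m) (Fin m) ℂ * (A x).map MvPolynomial.C)).det
  have hP : ∀ (g : Matrix (Fin m) (Fin m) ℂ) x k,
      MvPolynomial.eval (fun s : Fin m × Fin m => g s.1 s.2) (P x k) =
        (leadingSubmatrix (Nat.lt_succ_iff.mp k.2) (g * A x)).det := by
    intro g x k
    rw [RingHom.map_det]
    congr 1
    ext i l
    simp [leadingSubmatrix, Matrix.mul_apply]
  have hne : ∏ x, ∏ k, P x k ≠ 0 := by
    refine Finset.prod_ne_zero_iff.mpr fun x _ => Finset.prod_ne_zero_iff.mpr fun k _ h0 => ?_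
    have h := hP (A x)⁻¹ x k
    rw [h0, map_zero, Matrix.nonsing_inv_mul _ (hA x), leadingSubmatrix,
      Matrix.submatrix_one _ (Fin.castLE_injective _), Matrix.det_one] at h
    exact zero_ne_one h
  obtain ⟨s, hs⟩ : ∃ s : Fin m × Fin m → ℂ, MvPolynomial.eval s (∏ x, ∏ k, P x k) ≠ 0 := by
    by_contra! h
    exact hne (MvPolynomial.funext fun s => by rw [h s, map_zero])
  refine ⟨Matrix.of fun i l => s (i, l), fun x k hk => ?_⟩
  rw [map_prod, Finset.prod_ne_zero_iff] at hs
  have h1 := hs x (Finset.mem_univ x)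
  rw [map_prod, Finset.prod_ne_zero_iff] at h1
  have h2 := h1 ⟨k, Nat.lt_succ_iff.mpr hk⟩ (Finset.mem_univ _)
  rwa [← hP (Matrix.of fun i l => s (i, l)) x ⟨k, Nat.lt_succ_iff.mpr hk⟩]

/-- Lower triangular matrices with nonvanishing diagonal. -/
def lowerBorel (m : ℕ) : Set (Matrix (Fin m) (Fin m) ℂ) :=
  {h | h.IsLowerTriangular ∧ ∀ i, h i i ≠ 0}

lemma lowerBorel.isUnit_det {m : ℕ} {h : Matrix (Fin m) (Fin m) ℂ} (hh : h ∈ lowerBorel m) :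
    IsUnit h.det := by
  rw [Matrix.det_of_isLowerTriangular h hh.1, isUnit_iff_ne_zero]
  exact Finset.prod_ne_zero_iff.mpr fun i _ => hh.2 i

lemma leadingSubmatrix_mul {m k : ℕ} (hk : k ≤ m) {h : Matrix (Fin m) (Fin m) ℂ}
    (hh : h.IsLowerTriangular) (V : Matrix (Fin m) (Fin m) ℂ) :
    leadingSubmatrix hk (h * V) = leadingSubmatrix hk h * leadingSubmatrix hk V := by
  ext i l
  simp only [leadingSubmatrix, Matrix.submatrix_apply, Matrix.mul_apply]
  have hinj := Fin.castLE_injective hk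
  rw [← Finset.sum_image (s := Finset.univ) (g := Fin.castLE hk)
    (f := fun x => h (Fin.castLE hk i) x * V x (Fin.castLE hk l)) hinj.injOn]
  refine (Finset.sum_subset (Finset.subset_univ _) fun x _ hx => ?_).symm
  have hkx : k ≤ (x : ℕ) := by
    by_contra! hlt
    exact hx (Finset.mem_image.mpr ⟨⟨x, hlt⟩, Finset.mem_univ _, rfl⟩)
  rw [hh (show OrderDual.toDual x < OrderDual.toDual (Fin.castLE hk i) from ?_), zero_mul]
  exact Fin.lt_def.mpr (lt_of_lt_of_le i.2 hkx)

lemma det_leadingSubmatrix {m k : ℕ} (hk : k ≤ m) {h : Matrix (Fin m) (Fin m) ℂ}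
    (hh : h.IsLowerTriangular) :
    (leadingSubmatrix hk h).det = ∏ i : Fin k, h (Fin.castLE hk i) (Fin.castLE hk i) :=
  Matrix.det_of_isLowerTriangular _ fun _ _ hij => hh hij

lemma normSq_det_le {k : ℕ} {A : Matrix (Fin k) (Fin k) ℂ} {x : Fin k → ℝ}
    (hA : ∀ a i, Complex.normSq (A a i) ≤ x i) :
    Complex.normSq A.det ≤ (k.factorial : ℝ) ^ 2 * ∏ i, x i := by
  have hx : ∀ i, 0 ≤ x i := fun i => (Complex.normSq_nonneg _).trans (hA i i)
  have h : ‖A.det‖ ≤ k.factorial * ∏ i, Real.sqrt (x i) := by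
    rw [Matrix.det_apply]
    calc _ ≤ ∑ _σ : Equiv.Perm (Fin k), ∏ i, Real.sqrt (x i) := by
          refine norm_sum_le_of_le _ fun σ _ => ?_
          rw [Units.smul_def, zsmul_eq_mul, norm_mul, norm_prod]
          have hs : ‖(((Equiv.Perm.sign σ : ℤˣ) : ℤ) : ℂ)‖ = 1 := by
            rcases Int.units_eq_one_or (Equiv.Perm.sign σ) with h | h <;> simp [h]
          rw [hs, one_mul]
          refine Finset.prod_le_prod (fun _ _ => norm_nonneg _) fun i _ => ?_
          refine Real.le_sqrt_of_sq_le ?_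
          rw [← Complex.normSq_eq_norm_sq]
          exact hA _ _
      _ = _ := by simp [Fintype.card_perm]
  rw [Complex.normSq_eq_norm_sq]
  refine (pow_le_pow_left₀ (norm_nonneg _) h 2).trans_eq ?_
  rw [mul_pow, ← Finset.prod_pow]
  simp only [Real.sq_sqrt (hx _)]

lemma sum_log_sub_le {m k : ℕ} (hk : k ≤ m) {h : Matrix (Fin m) (Fin m) ℂ}
    (hh : h ∈ lowerBorel m) {w : Fin m → Fin m → ℂ} (hw : ∀ i, w i ≠ 0)
    (hmin : (leadingSubmatrix hk (Matrix.of w)ᵀ).det ≠ 0) :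
    ∑ i : Fin k, (Real.log (Complex.normSq (h (Fin.castLE hk i) (Fin.castLE hk i))) -
        Real.log (sqNorm (h *ᵥ w (Fin.castLE hk i)))) ≤
      Real.log ((k.factorial : ℝ) ^ 2) -
        Real.log (Complex.normSq (leadingSubmatrix hk (Matrix.of w)ᵀ).det) := by
  have hpos : ∀ i, 0 < sqNorm (h *ᵥ w i) := fun i =>
    sqNorm_pos (mulVec_ne_zero_of_isUnit_det (lowerBorel.isUnit_det hh) (hw i))
  have hdet : Complex.normSq (leadingSubmatrix hk (h * (Matrix.of w)ᵀ)).det ≤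
      (k.factorial : ℝ) ^ 2 * ∏ i : Fin k, sqNorm (h *ᵥ w (Fin.castLE hk i)) :=
    normSq_det_le fun a i => normSq_le_sqNorm (h *ᵥ w (Fin.castLE hk i)) (Fin.castLE hk a)
  rw [leadingSubmatrix_mul hk hh.1, Matrix.det_mul, det_leadingSubmatrix hk hh.1, map_mul,
    map_prod] at hdet
  have hd : ∀ i : Fin k, Complex.normSq (h (Fin.castLE hk i) (Fin.castLE hk i)) ≠ 0 := fun i =>
    (Complex.normSq_pos.mpr (hh.2 _)).ne'
  have hlog := Real.log_le_log (mul_pos (Finset.prod_pos fun i _ =>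
    Complex.normSq_pos.mpr (hh.2 _)) (Complex.normSq_pos.mpr hmin)) hdet
  rw [Real.log_mul (Finset.prod_ne_zero_iff.mpr fun i _ => hd i)
      (Complex.normSq_pos.mpr hmin).ne', Real.log_mul (by positivity)
      (Finset.prod_ne_zero_iff.mpr fun i _ => (hpos _).ne'),
    Real.log_prod fun i _ => hd i, Real.log_prod fun i _ => (hpos _).ne'] at hlog
  rw [Finset.sum_sub_distrib]
  linarith

/-- The logarithmic potential on lower triangular matrices whose critical points put `v` in
`diagonal q`-isotropic position. -/
def logPotential {m n : ℕ} (p : Fin n → ℝ) (q : Fin m → ℝ) (v : Fin n → Fin m → ℂ)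
    (h : Matrix (Fin m) (Fin m) ℂ) : ℝ :=
  ∑ j, p j * Real.log (sqNorm (h *ᵥ v j)) - ∑ i, q i * Real.log (Complex.normSq (h i i))

lemma exists_forall_le_logPotential {m n : ℕ} (u : Fin n → Fin m → ℂ) (p : Fin n → ℝ)
    {q : Fin m → ℝ} (hqa : Antitone q) (hq0 : ∀ i, 0 < q i) (hsum : ∑ j, p j = ∑ i, q i)
    (hF : ∀ J : Finset (Fin n), ∑ j ∈ J, p j ≤
      ∑ i ∈ Finset.univ.filter (fun i : Fin m =>
        (i : ℕ) < Module.finrank ℂ (Submodule.span ℂ (u '' (J : Set (Fin n))))), q i) :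
    ∃ g : Matrix (Fin m) (Fin m) ℂ, IsUnit g.det ∧ ∃ C : ℝ, ∀ h ∈ lowerBorel m,
      C ≤ logPotential p q (fun i => g *ᵥ u i) h := by
  classical
  have hfin : ∀ J : Finset (Fin n),
      Module.finrank ℂ (Submodule.span ℂ (u '' (J : Set (Fin n)))) ≤ m := fun J =>
    (Submodule.finrank_le _).trans_eq (Module.finrank_fin_fun ℂ)
  have hF' : ∀ J : Finset (Fin n), ∑ j ∈ J, p j ≤ ∑ i ∈ Finset.range
      (Module.finrank ℂ (Submodule.span ℂ (u '' (J : Set (Fin n))))), extendZero q i := by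
    intro J
    rw [sum_range_extendZero q (hfin J)]
    exact hF J
  have hrank : Module.finrank ℂ (Submodule.span ℂ (u '' ((Finset.univ : Finset (Fin n)) :
      Set (Fin n)))) = m := by
    refine le_antisymm (hfin Finset.univ) ?_
    by_contra! hlt
    have h1 := hF Finset.univ
    rw [hsum, ← Finset.sum_filter_add_sum_filter_not Finset.univ (fun i : Fin m =>
      (i : ℕ) < Module.finrank ℂ (Submodule.span ℂ (u '' ((Finset.univ : Finset (Fin n)) :
        Set (Fin n))))) q] at h1
    have h2 : 0 < ∑ i ∈ Finset.univ.filter (fun i : Fin m => ¬ (i : ℕ) < Module.finrank ℂ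
        (Submodule.span ℂ (u '' ((Finset.univ : Finset (Fin n)) : Set (Fin n))))), q i :=
      Finset.sum_pos (fun i _ => hq0 i) ⟨⟨_, hlt⟩, by simp⟩
    linarith
  have hunit : ∀ j : {j : Fin m → Fin n // LinearIndependent ℂ (u ∘ j)},
      IsUnit ((Matrix.of (u ∘ j.1))ᵀ).det := by
    intro j
    rw [Matrix.det_transpose, ← Matrix.isUnit_iff_isUnit_det,
      ← Matrix.linearIndependent_rows_iff_isUnit]
    exact j.2
  obtain ⟨g, hg⟩ := exists_forall_leading_minor_ne_zero
    (fun j : Option {j : Fin m → Fin n // LinearIndependent ℂ (u ∘ j)} =>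
      j.elim 1 fun j => (Matrix.of (u ∘ j.1))ᵀ)
    (by rintro (_ | j); exacts [by simp, hunit j])
  have hgdet : IsUnit g.det := by
    simpa [leadingSubmatrix] using hg none m le_rfl
  have hgV : ∀ j : Fin m → Fin n,
      g * (Matrix.of (u ∘ j))ᵀ = (Matrix.of fun i => g *ᵥ u (j i))ᵀ := fun j => rfl
  let K : (Fin m → Fin n) → ℕ → ℝ := fun j k =>
    if hk : k ≤ m then |Real.log ((k.factorial : ℝ) ^ 2) - Real.log (Complex.normSq
      (leadingSubmatrix hk (Matrix.of fun i => g *ᵥ u (j i))ᵀ).det)| else 0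
  have hK : ∀ j k, 0 ≤ K j k := by
    intro j k
    simp only [K]
    split_ifs <;> positivity
  let C : ℝ := ∑ j, ∑ k ∈ Finset.range (m + 1), K j k
  have hKC : ∀ j k, k ≤ m → K j k ≤ C := fun j k hk =>
    (Finset.single_le_sum (f := K j) (fun k _ => hK j k)
      (Finset.mem_range.mpr (Nat.lt_succ_iff.mpr hk))).trans
    (Finset.single_le_sum (f := fun j => ∑ k ∈ Finset.range (m + 1), K j k)
      (fun j _ => Finset.sum_nonneg fun k _ => hK j k) (Finset.mem_univ j))
  refine ⟨g, hgdet, -(extendZero q 0 * C), fun h hh => ?_⟩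
  set a : Fin n → ℝ := fun i => Real.log (sqNorm (h *ᵥ (g *ᵥ u i))) with ha
  obtain ⟨k, j, hli, hspan, hle⟩ := exists_greedy_basis u p a (extendZero q) hF' Finset.univ
  have hkm : k = m := by
    rw [← hrank, ← hspan, finrank_span_eq_card hli, Fintype.card_fin]
  subst hkm
  obtain ⟨t, ht⟩ : ∃ t, ∀ i ∈ Finset.univ, a i ≤ t :=
    ⟨∑ i, |a i|, fun i _ => (le_abs_self _).trans
      (Finset.single_le_sum (f := fun i => |a i|) (fun _ _ => abs_nonneg _) (Finset.mem_univ i))⟩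
  have h1 : ∑ i, q i * a (j i) ≤ ∑ i, p i * a i := by
    have := hle t ht
    simp only [extendZero_val, mul_sub, Finset.sum_sub_distrib, ← Finset.sum_mul, hsum] at this
    linarith
  have h2 : ∑ i, q i * (Real.log (Complex.normSq (h i i)) - a (j i)) ≤ extendZero q 0 * C := by
    refine sum_mul_le_of_partial_sum_le hqa (fun i => (hq0 i).le) fun l hl => ?_
    refine le_trans ?_ (hKC j l hl)
    simp only [K, dif_pos hl]
    refine le_trans ?_ (le_abs_self _)
    refine sum_log_sub_le hl hh (w := fun i => g *ᵥ u (j i)) (fun i =>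
      mulVec_ne_zero_of_isUnit_det hgdet (hli.ne_zero i)) ?_
    rw [← hgV]
    exact hg (some ⟨j, hli⟩) l hl
  simp only [mul_sub, Finset.sum_sub_distrib] at h2
  rw [logPotential]
  linarith

/-- Add `c` times row `b` to row `a`. -/
def addRow {m : ℕ} (a b : Fin m) (c : ℂ) (h : Matrix (Fin m) (Fin m) ℂ) :
    Matrix (Fin m) (Fin m) ℂ :=
  fun i l => h i l + if i = a then c * h b l else 0

lemma addRow_mulVec {m : ℕ} (a b : Fin m) (c : ℂ) (h : Matrix (Fin m) (Fin m) ℂ)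
    (x : Fin m → ℂ) (i : Fin m) :
    (addRow a b c h *ᵥ x) i = (h *ᵥ x) i + if i = a then c * (h *ᵥ x) b else 0 := by
  simp only [Matrix.mulVec, dotProduct, addRow, add_mul, Finset.sum_add_distrib]
  split_ifs
  · simp only [Finset.mul_sum, mul_assoc]
  · simp

lemma sqNorm_addRow_mulVec {m : ℕ} (a b : Fin m) (c : ℂ) (h : Matrix (Fin m) (Fin m) ℂ)
    (x : Fin m → ℂ) :
    sqNorm (addRow a b c h *ᵥ x) = sqNorm (h *ᵥ x) +
      (2 * (c * ((h *ᵥ x) b * star ((h *ᵥ x) a))).re +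
        Complex.normSq c * Complex.normSq ((h *ᵥ x) b)) := by
  have hpt : ∀ i, Complex.normSq ((addRow a b c h *ᵥ x) i) = Complex.normSq ((h *ᵥ x) i) +
      if i = a then 2 * (c * ((h *ᵥ x) b * star ((h *ᵥ x) a))).re +
        Complex.normSq c * Complex.normSq ((h *ᵥ x) b) else 0 := by
    intro i
    rw [addRow_mulVec]
    split_ifs with hi
    · subst hi
      simp [Complex.normSq_apply]
      ring
    · simp
  simp only [sqNorm, hpt, Finset.sum_add_distrib, Finset.sum_ite_eq', Finset.mem_univ, if_true]

lemma addRow_isLowerTriangular {m : ℕ} {a b : Fin m} (hab : b ≤ a) (c : ℂ)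
    {h : Matrix (Fin m) (Fin m) ℂ} (hh : h.IsLowerTriangular) :
    (addRow a b c h).IsLowerTriangular := by
  intro i l hil
  have hil' : i < l := hil
  rw [addRow, hh hil, zero_add]
  split_ifs with hi
  · rw [hh (show OrderDual.toDual l < OrderDual.toDual b from (hab.trans_eq hi.symm).trans_lt hil'),
      mul_zero]
  · rfl

lemma addRow_apply_self_of_lt {m : ℕ} {a b : Fin m} (hab : b < a) (c : ℂ)
    {h : Matrix (Fin m) (Fin m) ℂ} (hh : h.IsLowerTriangular) (i : Fin m) :
    addRow a b c h i i = h i i := by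
  rw [addRow]
  split_ifs with hi
  · subst hi
    rw [hh (show OrderDual.toDual i < OrderDual.toDual b from hab), mul_zero, add_zero]
  · rw [add_zero]

lemma sum_log_addRow_le {m n : ℕ} {p : Fin n → ℝ} (hp : ∀ i, 0 ≤ p i) (a b : Fin m) (c : ℂ)
    {h : Matrix (Fin m) (Fin m) ℂ} {v : Fin n → Fin m → ℂ} (hv : ∀ i, h *ᵥ v i ≠ 0)
    (hv' : ∀ i, addRow a b c h *ᵥ v i ≠ 0) :
    ∑ i, p i * Real.log (sqNorm (addRow a b c h *ᵥ v i)) ≤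
      ∑ i, p i * Real.log (sqNorm (h *ᵥ v i)) +
        (2 * (c * isoMatrix p (fun i => h *ᵥ v i) b a).re + Complex.normSq c * ∑ i, p i) := by
  have hpt : ∀ i, p i * Real.log (sqNorm (addRow a b c h *ᵥ v i)) ≤
      p i * Real.log (sqNorm (h *ᵥ v i)) +
        (2 * (c * (((p i / sqNorm (h *ᵥ v i) : ℝ) : ℂ) *
          ((h *ᵥ v i) b * star ((h *ᵥ v i) a)))).re + Complex.normSq c * p i) := by
    intro i
    have h0 := sqNorm_pos (hv i)
    have h1 := sqNorm_pos (hv' i)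
    have hlog := Real.log_le_sub_one_of_pos (div_pos h1 h0)
    rw [Real.log_div h1.ne' h0.ne'] at hlog
    have hre : (c * (((p i / sqNorm (h *ᵥ v i) : ℝ) : ℂ) *
        ((h *ᵥ v i) b * star ((h *ᵥ v i) a)))).re =
        p i / sqNorm (h *ᵥ v i) * (c * ((h *ᵥ v i) b * star ((h *ᵥ v i) a))).re := by
      rw [mul_left_comm, Complex.re_ofReal_mul]
    rw [hre]
    have hb : Complex.normSq c * (Complex.normSq ((h *ᵥ v i) b) / sqNorm (h *ᵥ v i)) ≤
        Complex.normSq c := mul_le_of_le_one_right (Complex.normSq_nonneg c)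
      ((div_le_one h0).mpr (normSq_le_sqNorm _ b))
    have hdiv : sqNorm (addRow a b c h *ᵥ v i) / sqNorm (h *ᵥ v i) - 1 =
        2 * (c * ((h *ᵥ v i) b * star ((h *ᵥ v i) a))).re / sqNorm (h *ᵥ v i) +
          Complex.normSq c * (Complex.normSq ((h *ᵥ v i) b) / sqNorm (h *ᵥ v i)) := by
      rw [sqNorm_addRow_mulVec]
      field_simp
      ring
    rw [hdiv] at hlog
    calc _ ≤ p i * (Real.log (sqNorm (h *ᵥ v i)) +
          (2 * (c * ((h *ᵥ v i) b * star ((h *ᵥ v i) a))).re / sqNorm (h *ᵥ v i) +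
            Complex.normSq c)) := mul_le_mul_of_nonneg_left (by linarith) (hp i)
      _ = _ := by ring
  refine (Finset.sum_le_sum fun i _ => hpt i).trans_eq ?_
  rw [isoMatrix_apply, Finset.mul_sum, Complex.re_sum, Finset.mul_sum, Finset.mul_sum,
    Finset.sum_add_distrib, Finset.sum_add_distrib]

/-- The strictly triangular part of `isoMatrix` is small at an almost-minimizer. -/
lemma normSq_isoMatrix_le_of_almost_min {m n : ℕ} {p : Fin n → ℝ} (hp : ∀ i, 0 ≤ p i)
    (q : Fin m → ℝ) {v : Fin n → Fin m → ℂ} (hv : ∀ i, v i ≠ 0) {δ : ℝ}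
    {h : Matrix (Fin m) (Fin m) ℂ} (hh : h ∈ lowerBorel m)
    (hmin : ∀ h' ∈ lowerBorel m, logPotential p q v h - δ ≤ logPotential p q v h')
    {a b : Fin m} (hab : b < a) :
    Complex.normSq (isoMatrix p (fun i => h *ᵥ v i) b a) ≤ (∑ i, p i + 1) * δ := by
  set P := ∑ i, p i with hP
  have hP0 : 0 ≤ P := Finset.sum_nonneg fun i _ => hp i
  set z := isoMatrix p (fun i => h *ᵥ v i) b a with hz
  set c : ℂ := ((-(1 / (P + 1)) : ℝ) : ℂ) * star z with hc
  have hh' : addRow a b c h ∈ lowerBorel m :=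
    ⟨addRow_isLowerTriangular hab.le c hh.1, fun i => by
      rw [addRow_apply_self_of_lt hab c hh.1]; exact hh.2 i⟩
  have hne := fun {h' : Matrix (Fin m) (Fin m) ℂ} (h1 : h' ∈ lowerBorel m) i =>
    mulVec_ne_zero_of_isUnit_det (lowerBorel.isUnit_det h1) (hv i)
  have h1 := sum_log_addRow_le hp a b c (hne hh) (hne hh')
  have h2 := hmin _ hh'
  simp only [logPotential, addRow_apply_self_of_lt hab c hh.1] at h2
  have hre : (c * z).re = -(1 / (P + 1)) * Complex.normSq z := by
    rw [hc, mul_assoc, Complex.re_ofReal_mul]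
    simp [Complex.normSq_apply]
  have hcn : Complex.normSq c = (1 / (P + 1)) ^ 2 * Complex.normSq z := by
    rw [hc, map_mul, Complex.normSq_ofReal]
    simp [sq]
  rw [← hz, ← hP, hre, hcn] at h1
  have h3 : Complex.normSq z * (2 * (1 / (P + 1)) - (1 / (P + 1)) ^ 2 * P) ≤ δ := by linarith
  have h4 : 1 / (P + 1) ≤ 2 * (1 / (P + 1)) - (1 / (P + 1)) ^ 2 * P := by
    rw [← sub_nonneg]
    have : 2 * (1 / (P + 1)) - (1 / (P + 1)) ^ 2 * P - 1 / (P + 1) = 1 / (P + 1) ^ 2 := by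
      field_simp
      ring
    rw [this]
    positivity
  have h5 := (mul_le_mul_of_nonneg_left h4 (Complex.normSq_nonneg z)).trans h3
  rw [mul_one_div, div_le_iff₀ (by positivity)] at h5
  linarith

lemma isoMatrix_diag_le_of_almost_min {m n : ℕ} {p : Fin n → ℝ} (hp : ∀ i, 0 ≤ p i)
    {q : Fin m → ℝ} (hq0 : ∀ i, 0 ≤ q i) {v : Fin n → Fin m → ℂ} (hv : ∀ i, v i ≠ 0) {δ : ℝ}
    {h : Matrix (Fin m) (Fin m) ℂ} (hh : h ∈ lowerBorel m)
    (hmin : ∀ h' ∈ lowerBorel m, logPotential p q v h - δ ≤ logPotential p q v h')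
    (a : Fin m) {t : ℝ} (ht : |t| ≤ 1 / 2) :
    -δ ≤ 2 * t * ((isoMatrix p (fun i => h *ᵥ v i) a a).re - q a) +
      t ^ 2 * (∑ i, p i + 4 * q a) := by
  obtain ⟨ht1, ht2⟩ := abs_le.mp ht
  have ht0 : 0 < 1 + t := by linarith
  have hdiag : ∀ i, addRow a a (t : ℂ) h i i = (if i = a then ((1 + t : ℝ) : ℂ) else 1) * h i i := by
    intro i
    rw [addRow]
    split_ifs with hi
    · subst hi
      push_cast
      ring
    · ring
  have hh' : addRow a a (t : ℂ) h ∈ lowerBorel m := by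
    refine ⟨addRow_isLowerTriangular le_rfl _ hh.1, fun i => ?_⟩
    rw [hdiag]
    refine mul_ne_zero ?_ (hh.2 i)
    split_ifs
    · exact_mod_cast ht0.ne'
    · exact one_ne_zero
  have hne := fun {h' : Matrix (Fin m) (Fin m) ℂ} (h1 : h' ∈ lowerBorel m) i =>
    mulVec_ne_zero_of_isUnit_det (lowerBorel.isUnit_det h1) (hv i)
  have h1 := sum_log_addRow_le hp a a t (hne hh) (hne hh')
  have h2 := hmin _ hh'
  have h3 : ∑ i, q i * Real.log (Complex.normSq (addRow a a (t : ℂ) h i i)) =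
      ∑ i, q i * Real.log (Complex.normSq (h i i)) + q a * (2 * Real.log (1 + t)) := by
    have hpt : ∀ i, q i * Real.log (Complex.normSq (addRow a a (t : ℂ) h i i)) =
        q i * Real.log (Complex.normSq (h i i)) +
          if i = a then q a * (2 * Real.log (1 + t)) else 0 := by
      intro i
      rw [hdiag]
      split_ifs with hi
      · subst hi
        rw [map_mul, Complex.normSq_ofReal, Real.log_mul (mul_pos ht0 ht0).ne'
          (Complex.normSq_pos.mpr (hh.2 i)).ne', Real.log_mul ht0.ne' ht0.ne']
        ring
      · rw [one_mul, add_zero]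
    simp only [hpt, Finset.sum_add_distrib, Finset.sum_ite_eq', Finset.mem_univ, if_true]
  have hlog : t - 2 * t ^ 2 ≤ Real.log (1 + t) := by
    refine le_trans ?_ (Real.one_sub_inv_le_log_of_pos ht0)
    have : 1 - (1 + t)⁻¹ - (t - 2 * t ^ 2) = t ^ 2 * (1 + 2 * t) / (1 + t) := by
      field_simp
      ring
    have h0 : 0 ≤ t ^ 2 * (1 + 2 * t) / (1 + t) :=
      div_nonneg (mul_nonneg (sq_nonneg t) (by linarith)) ht0.le
    linarith
  rw [Complex.re_ofReal_mul, Complex.normSq_ofReal] at h1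
  simp only [logPotential, h3] at h2
  have h4 := mul_le_mul_of_nonneg_left hlog (hq0 a)
  nlinarith

lemma isoMatrix_conj_apply {m n : ℕ} (p : Fin n → ℝ) (v : Fin n → Fin m → ℂ) (a b : Fin m) :
    star (isoMatrix p v a b) = isoMatrix p v b a := by
  rw [isoMatrix_apply, isoMatrix_apply, star_sum]
  refine Finset.sum_congr rfl fun i _ => ?_
  simp [mul_comm]

theorem approxIso_diagonal_of_sum_le {m n : ℕ} {u : Fin n → Fin m → ℂ} (hu : ∀ i, u i ≠ 0)
    {p : Fin n → ℝ} (hp : ∀ i, 0 ≤ p i) {q : Fin m → ℝ} (hqa : Antitone q) (hq0 : ∀ i, 0 < q i)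
    (hsum : ∑ j, p j = ∑ i, q i)
    (hF : ∀ J : Finset (Fin n), ∑ j ∈ J, p j ≤
      ∑ i ∈ Finset.univ.filter (fun i : Fin m =>
        (i : ℕ) < Module.finrank ℂ (Submodule.span ℂ (u '' (J : Set (Fin n))))), q i) :
    approxIso u p (Matrix.diagonal fun i => (q i : ℂ)) := by
  rw [approxIso_iff_isoMatrix]
  intro ε hε
  obtain ⟨g, hg, C, hC⟩ := exists_forall_le_logPotential u p hqa hq0 hsum hF
  set v : Fin n → Fin m → ℂ := fun i => g *ᵥ u i with hvdef
  have hv : ∀ i, v i ≠ 0 := fun i => mulVec_ne_zero_of_isUnit_det hg (hu i)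
  have hP0 : 0 ≤ ∑ i, p i := Finset.sum_nonneg fun i _ => hp i
  have hQ0 : ∀ i, q i ≤ ∑ i, q i := fun i =>
    Finset.single_le_sum (fun i _ => (hq0 i).le) (Finset.mem_univ i)
  set η := ε / (m + 1) with hη
  have hη0 : 0 < η := by positivity
  set K := ∑ i, p i + 4 * ∑ i, q i + 1 with hK
  have hK0 : 0 < K := by linarith
  set s := min (1 / 2) (η / K) with hs
  have hs0 : 0 < s := lt_min (by norm_num) (div_pos hη0 hK0)
  have hsK : s * K ≤ η := (le_div_iff₀ hK0).mp (min_le_right _ _)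
  have hs2 : |s| ≤ 1 / 2 := by rw [abs_of_pos hs0]; exact min_le_left _ _
  set δ := min (s * η) (η ^ 2 / (∑ i, p i + 1)) with hδ
  have hδ0 : 0 < δ := lt_min (by positivity) (by positivity)
  have hone : (1 : Matrix (Fin m) (Fin m) ℂ) ∈ lowerBorel m :=
    ⟨Matrix.blockTriangular_one, fun i => by simp⟩
  have hbdd : BddBelow (logPotential p q v '' lowerBorel m) :=
    ⟨C, by rintro _ ⟨h, hh, rfl⟩; exact hC h hh⟩
  obtain ⟨_, ⟨h, hh, rfl⟩, hlt⟩ := Real.lt_sInf_add_pos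
    (Set.Nonempty.image (logPotential p q v) ⟨1, hone⟩) hδ0
  have hmin : ∀ h' ∈ lowerBorel m, logPotential p q v h - δ ≤ logPotential p q v h' := by
    intro h' hh'
    linarith [csInf_le hbdd (Set.mem_image_of_mem _ hh')]
  refine ⟨h * g, by rw [Matrix.det_mul]; exact (lowerBorel.isUnit_det hh).mul hg, ?_⟩
  have hentry : ∀ a b, ‖(isoMatrix p (fun i => h *ᵥ v i) -
      Matrix.diagonal fun i => (q i : ℂ)) a b‖ ≤ η := by
    have hoff : ∀ {a b : Fin m}, b < a → ‖isoMatrix p (fun i => h *ᵥ v i) b a‖ ≤ η := by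
      intro a b hab
      have h1 := normSq_isoMatrix_le_of_almost_min hp q hv hh hmin hab
      have h2 : (∑ i, p i + 1) * δ ≤ η ^ 2 := by
        rw [mul_comm]
        exact (le_div_iff₀ (by positivity)).mp (min_le_right _ _)
      rw [Complex.normSq_eq_norm_sq] at h1
      exact le_of_sq_le_sq (h1.trans h2) hη0.le
    intro a b
    rw [Matrix.sub_apply]
    rcases lt_trichotomy a b with hab | rfl | hab
    · rw [Matrix.diagonal_apply_ne _ hab.ne, sub_zero]
      exact hoff hab
    · have hreal : isoMatrix p (fun i => h *ᵥ v i) a a =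
          ((isoMatrix p (fun i => h *ᵥ v i) a a).re : ℂ) :=
        (Complex.conj_eq_iff_re.mp (isoMatrix_conj_apply p _ a a)).symm
      have h1 := isoMatrix_diag_le_of_almost_min hp (fun i => (hq0 i).le) hv hh hmin a hs2
      have h2 := isoMatrix_diag_le_of_almost_min hp (fun i => (hq0 i).le) hv hh hmin a
        (t := -s) (by rwa [abs_neg])
      have h3 : s ^ 2 * (∑ i, p i + 4 * q a) ≤ s * η := by
        rw [sq, mul_assoc]
        refine mul_le_mul_of_nonneg_left (le_trans ?_ hsK) hs0.le
        exact mul_le_mul_of_nonneg_left (by linarith [hQ0 a]) hs0.le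
      have h4 : δ ≤ s * η := min_le_left _ _
      rw [Matrix.diagonal_apply_eq, hreal, ← Complex.ofReal_sub, Complex.norm_real,
        Real.norm_eq_abs, abs_le]
      constructor <;> refine le_of_mul_le_mul_left ?_ hs0 <;> nlinarith
    · rw [Matrix.diagonal_apply_ne _ hab.ne', sub_zero, ← isoMatrix_conj_apply, norm_star]
      exact hoff hab
  have hfrob := frob_le_of_norm_le hη0.le hentry
  simp only [hvdef, Matrix.mulVec_mulVec] at hfrob
  refine hfrob.trans ?_
  rw [hη, mul_div_assoc', div_le_iff₀ (by positivity)]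
  nlinarith

/-- Proposition: `(u_1,…,u_n)` can be approximately put in `Q`-isotropic position with respect
to `p` iff `Σ p = Σ q` and `Σ_{j∈J} p_j ≤ q_1 + ⋯ + q_{d(J)}` for every `J ⊆ [n]`, where
`d(J) = dim span{u_j : j ∈ J}` and `q` is the nonincreasing spectrum of `Q`. -/
theorem stmt17 {m n : ℕ} (u : Fin n → Fin m → ℂ) (hu : ∀ i, u i ≠ 0)
    (p : Fin n → ℝ) (hp : ∀ i, 0 ≤ p i)
    (q : Fin m → ℝ) (hqa : Antitone q) (hq0 : ∀ i, 0 < q i)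
    (Q : Matrix (Fin m) (Fin m) ℂ)
    (hQ : ∃ U ∈ Matrix.unitaryGroup (Fin m) ℂ,
      Q = U * Matrix.diagonal (fun i => (q i : ℂ)) * Uᴴ) :
    approxIso u p Q ↔
      ((∑ j, p j = ∑ i, q i) ∧
        ∀ J : Finset (Fin n), ∑ j ∈ J, p j ≤
          ∑ i ∈ Finset.univ.filter
              (fun i : Fin m =>
                (i : ℕ) < Module.finrank ℂ (Submodule.span ℂ (u '' (J : Set (Fin n))))),
            q i) := by
  obtain ⟨U, hU, rfl⟩ := hQ
  rw [approxIso_unitary_conj_iff hU]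
  exact ⟨fun h => h.sum_eq_and_sum_le hu hp hqa fun i => (hq0 i).le,
    fun h => approxIso_diagonal_of_sum_le hu hp hqa hq0 h.1 h.2⟩
end
end
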